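/- Fix a point p ∈ ℙ²(ℂ), and let W denote the projective space of plane quartics that are singular at p. The set of irreducible quartics X whose only singularity is an ordinary node at p and for which there exists an irreducible quartic Y ≠ X, whose only singularity is an ordinary node at p, having the same set of theta-lines as X, is contained in a proper Zariski-closed subset of W. In other words, a general one-nodal quartic is uniquely determined, among one-nodal quartics with the same node, by its theta-lines. -/

import Mathlib

open MvPolynomial

noncomputable section

abbrev P2 : Type := Projectivization ℂ (Fin 3 → ℂ)

/-- The zero locus in `ℙ²` of a polynomial `F`: the points all of whose
representative vectors are zeros of `F`. -/
def curve (F : MvPolynomial (Fin 3) ℂ) : Set P2 :=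
  {p | ∀ (w : Fin 3 → ℂ) (hw : w ≠ 0), Projectivization.mk ℂ w hw = p → eval w F = 0}

/-- The projective line spanned by two vectors. -/
def lineThrough (u v : Fin 3 → ℂ) : Set P2 :=
  {p | ∃ s t : ℂ, ∃ h : s • u + t • v ≠ 0, p = Projectivization.mk ℂ (s • u + t • v) h}

/-- A subset of `ℙ²` is a line if it is the projective span of two
linearly independent vectors. -/
def IsLine (S : Set P2) : Prop :=
  ∃ u v : Fin 3 → ℂ, LinearIndependent ℂ ![u, v] ∧ S = lineThrough u v

/-- The restriction of `F` to the affine parametrization `t ↦ a + t • b` of the line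
through `[a]` and `[b]`, as a polynomial in `t`. -/
def lineRest (F : MvPolynomial (Fin 3) ℂ) (a b : Fin 3 → ℂ) : Polynomial ℂ :=
  eval₂ Polynomial.C (fun i => Polynomial.C (a i) + Polynomial.X * Polynomial.C (b i)) F

/-- The local intersection multiplicity, at the point `[a]`, of the curve `F = 0` with the
line through `[a]` and `[b]` (parametrized by `t ↦ a + t • b`, the point `[a]`
corresponding to `t = 0`). -/
def multAt (F : MvPolynomial (Fin 3) ℂ) (a b : Fin 3 → ℂ) : ℕ :=
  Polynomial.rootMultiplicity 0 (lineRest F a b)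

/-- The scheme `X ∩ L` (for `X = {F = 0}`, `L` a line) is everywhere nonreduced: at each
point of `X ∩ L` the local intersection multiplicity is at least `2`.  (Stated over all
parametrizations of `L`; the base point `a` of a parametrization is a point of `L`, and
every point of `L` occurs as such a base point.) -/
def EverywhereTangent (F : MvPolynomial (Fin 3) ℂ) (S : Set P2) : Prop :=
  ∀ a b : Fin 3 → ℂ, LinearIndependent ℂ ![a, b] → S = lineThrough a b →
    ∀ ha : a ≠ 0, Projectivization.mk ℂ a ha ∈ curve F → 2 ≤ multAt F a b

/-- A theta-line of the quartic `F`: either contained in the curve, or intersecting it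
everywhere nonreducedly. -/
def ThetaLine (F : MvPolynomial (Fin 3) ℂ) (S : Set P2) : Prop :=
  IsLine S ∧ (S ⊆ curve F ∨ EverywhereTangent F S)

/-- A bitangent line of (a smooth curve) `F = 0`: a line, not contained in the curve,
whose scheme-theoretic intersection with the curve is everywhere nonreduced. -/
def Bitangent (F : MvPolynomial (Fin 3) ℂ) (S : Set P2) : Prop :=
  IsLine S ∧ ¬ S ⊆ curve F ∧ EverywhereTangent F S

/-- The line `S` is tangent to the curve `F = 0` at the point `q`: the local intersection
multiplicity there is at least `2`. -/
def TangentAt (F : MvPolynomial (Fin 3) ℂ) (S : Set P2) (q : P2) : Prop :=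
  IsLine S ∧ q ∈ S ∧ q ∈ curve F ∧
    ∀ a b : Fin 3 → ℂ, LinearIndependent ℂ ![a, b] → S = lineThrough a b →
      ∀ ha : a ≠ 0, Projectivization.mk ℂ a ha = q → 2 ≤ multAt F a b

/-- The curve `F = 0` is smooth: `F` and its partial derivatives have no common
projective zero. -/
def SmoothCurve (F : MvPolynomial (Fin 3) ℂ) : Prop :=
  ∀ w : Fin 3 → ℂ, w ≠ 0 → ¬ (eval w F = 0 ∧ ∀ i : Fin 3, eval w (pderiv i F) = 0)

/-- Iterated partial derivative along a list of coordinate directions. -/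
def pderivList (l : List (Fin 3)) (F : MvPolynomial (Fin 3) ℂ) : MvPolynomial (Fin 3) ℂ :=
  l.foldr (fun i G => pderiv i G) F

/-- `F` vanishes to order at least `m` at the point `p` (all partial derivatives of
order `< m` vanish at `p`); i.e. `p` is a point of multiplicity at least `m` of `F = 0`. -/
def VanishesToOrder (F : MvPolynomial (Fin 3) ℂ) (p : P2) (m : ℕ) : Prop :=
  ∀ l : List (Fin 3), l.length < m →
    ∀ (w : Fin 3 → ℂ) (hw : w ≠ 0), Projectivization.mk ℂ w hw = p →
      eval w (pderivList l F) = 0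

/-- `p` is a singular point of the curve `F = 0`. -/
def IsSingularAt (F : MvPolynomial (Fin 3) ℂ) (p : P2) : Prop :=
  VanishesToOrder F p 2

/-- `p` is a double point: a point of multiplicity exactly `2`. -/
def IsDoublePoint (F : MvPolynomial (Fin 3) ℂ) (p : P2) : Prop :=
  VanishesToOrder F p 2 ∧ ¬ VanishesToOrder F p 3

/-- The quadratic form (in the direction `b`) cutting out the tangent cone of `F = 0`
at the double point `[a]`: the degree-`2` Taylor coefficient of `t ↦ F (a + t • b)`. -/
def coneCoeff (F : MvPolynomial (Fin 3) ℂ) (a b : Fin 3 → ℂ) : ℂ :=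
  (lineRest F a b).coeff 2

/-- `p` is an ordinary node: a double point whose tangent cone consists of two distinct
lines, i.e. the tangent-cone quadratic has two null directions independent modulo `a`. -/
def OrdinaryNode (F : MvPolynomial (Fin 3) ℂ) (p : P2) : Prop :=
  IsDoublePoint F p ∧
    ∀ (a : Fin 3 → ℂ) (ha : a ≠ 0), Projectivization.mk ℂ a ha = p →
      ∃ b₁ b₂ : Fin 3 → ℂ, LinearIndependent ℂ ![a, b₁, b₂] ∧
        coneCoeff F a b₁ = 0 ∧ coneCoeff F a b₂ = 0

/-- At the double point `[a]`, the tangent cone is the double line through `[a]` and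
`[b₀]`: `b₀` is a null direction of the tangent-cone quadratic, and every null
direction lies on the line spanned by `a` and `b₀`. -/
def DoubleLineCone (F : MvPolynomial (Fin 3) ℂ) (a b₀ : Fin 3 → ℂ) : Prop :=
  LinearIndependent ℂ ![a, b₀] ∧ coneCoeff F a b₀ = 0 ∧
    ∀ b : Fin 3 → ℂ, coneCoeff F a b = 0 → b ∈ Submodule.span ℂ ({a, b₀} : Set (Fin 3 → ℂ))

/-- `p` is an ordinary cusp: a double point whose tangent cone is a double line `L₀`
with local intersection multiplicity `i(L₀ · X) = 3` at `p`. -/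
def OrdinaryCusp (F : MvPolynomial (Fin 3) ℂ) (p : P2) : Prop :=
  IsDoublePoint F p ∧
    ∀ (a : Fin 3 → ℂ) (ha : a ≠ 0), Projectivization.mk ℂ a ha = p →
      ∃ b₀ : Fin 3 → ℂ, DoubleLineCone F a b₀ ∧ multAt F a b₀ = 3

/-- `p` is an ordinary tacnode: a double point whose tangent cone is a double line `L₀`
with local intersection multiplicity `i(L₀ · X) = 4` at `p`. -/
def OrdinaryTacnode (F : MvPolynomial (Fin 3) ℂ) (p : P2) : Prop :=
  IsDoublePoint F p ∧
    ∀ (a : Fin 3 → ℂ) (ha : a ≠ 0), Projectivization.mk ℂ a ha = p →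
      ∃ b₀ : Fin 3 → ℂ, DoubleLineCone F a b₀ ∧ multAt F a b₀ = 4

/-- A theta-line of type `i`: a theta-line, not a component of the curve, containing
exactly `i` singular points of the curve. -/
def ThetaLineOfType (F : MvPolynomial (Fin 3) ℂ) (i : ℕ) (S : Set P2) : Prop :=
  ThetaLine F S ∧ ¬ S ⊆ curve F ∧ {p | p ∈ S ∧ IsSingularAt F p}.ncard = i

/-- Three points of `ℙ²` are collinear. -/
def Collin (p q r : P2) : Prop :=
  ∃ S : Set P2, IsLine S ∧ p ∈ S ∧ q ∈ S ∧ r ∈ S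


/-- An ordinary bitangent: a bitangent meeting the curve at exactly two distinct points,
each with local intersection multiplicity exactly `2`. -/
def OrdinaryBitangent (F : MvPolynomial (Fin 3) ℂ) (S : Set P2) : Prop :=
  Bitangent F S ∧ (S ∩ curve F).ncard = 2 ∧
    ∀ a b : Fin 3 → ℂ, LinearIndependent ℂ ![a, b] → S = lineThrough a b →
      ∀ ha : a ≠ 0, Projectivization.mk ℂ a ha ∈ curve F → multAt F a b = 2

/-- A bitangent meeting the curve only at smooth points. -/
def SmoothBitangent (F : MvPolynomial (Fin 3) ℂ) (S : Set P2) : Prop :=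
  Bitangent F S ∧ ∀ p ∈ S ∩ curve F, ¬ IsSingularAt F p

section NormalForm

variable {A : Type*} [CommRing A]

/-- Coefficient sequence of `(q U - p V) * ∑ k i U ^ (d - i) V ^ i`. -/
def mulLin (q p : A) (k : ℕ → A) : ℕ → A
  | 0 => q * k 0
  | n + 1 => q * k (n + 1) - p * k n

/-- The coefficient of `U ^ (6 - i) V ^ i` in `∏ j, (q j U - p j V)`. -/
def sexticCoeff (p q : Fin 6 → A) : ℕ → A :=
  mulLin (q 0) (p 0) (mulLin (q 1) (p 1) (mulLin (q 2) (p 2) (mulLin (q 3) (p 3)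
    (mulLin (q 4) (p 4) (mulLin (q 5) (p 5) (fun n => if n = 0 then 1 else 0))))))

/-- The even part of `∏ j, (q j U - p j V)`, as a cubic form in `U ^ 2`, `V ^ 2`. -/
def evenPart (p q : Fin 6 → A) (X Y : A) : A :=
  sexticCoeff p q 0 * X ^ 3 + sexticCoeff p q 2 * X ^ 2 * Y + sexticCoeff p q 4 * X * Y ^ 2
    + sexticCoeff p q 6 * Y ^ 3

/-- The odd part of `∏ j, (q j U - p j V)` divided by `U V`, as a quadratic form in
`U ^ 2`, `V ^ 2`. -/
def oddPart (p q : Fin 6 → A) (X Y : A) : A :=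
  sexticCoeff p q 1 * X ^ 2 + sexticCoeff p q 3 * X * Y + sexticCoeff p q 5 * Y ^ 2

/-- The quartic with a node whose six tangents through the node are `q j ^ 2 X = p j ^ 2 Y`. -/
def nodalQuartic (p q : Fin 6 → A) (X Y z : A) : A :=
  X * Y * z ^ 2 + 2 * evenPart p q X Y * z + oddPart p q X Y ^ 2

theorem sexticCoeff_prod (p q : Fin 6 → A) (U V : A) :
    sexticCoeff p q 0 * U ^ 6 + sexticCoeff p q 1 * U ^ 5 * V + sexticCoeff p q 2 * U ^ 4 * V ^ 2
      + sexticCoeff p q 3 * U ^ 3 * V ^ 3 + sexticCoeff p q 4 * U ^ 2 * V ^ 4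
      + sexticCoeff p q 5 * U * V ^ 5 + sexticCoeff p q 6 * V ^ 6
      = ∏ j, (q j * U - p j * V) := by
  simp only [sexticCoeff, mulLin, Fin.prod_univ_six]
  norm_num
  ring

theorem sexticCoeff_zero (p q : Fin 6 → A) : sexticCoeff p q 0 = ∏ j, q j := by
  simp only [sexticCoeff, mulLin, Fin.prod_univ_six]
  norm_num
  ring

theorem sexticCoeff_six (p q : Fin 6 → A) : sexticCoeff p q 6 = ∏ j, p j := by
  simp only [sexticCoeff, mulLin, Fin.prod_univ_six]
  norm_num
  ring

theorem evenPart_add_oddPart (p q : Fin 6 → A) (U V : A) :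
    evenPart p q (U ^ 2) (V ^ 2) + U * V * oddPart p q (U ^ 2) (V ^ 2)
      = ∏ j, (q j * U - p j * V) := by
  rw [← sexticCoeff_prod, evenPart, oddPart]
  ring

theorem evenPart_sub_oddPart (p q : Fin 6 → A) (U V : A) :
    evenPart p q (U ^ 2) (V ^ 2) - U * V * oddPart p q (U ^ 2) (V ^ 2)
      = ∏ j, (q j * U + p j * V) := by
  have h := evenPart_add_oddPart p q U (-V)
  simp only [mul_neg, sub_neg_eq_add, neg_sq, neg_mul] at h
  rw [← h]
  ring

theorem map_sexticCoeff {B : Type*} [CommRing B] (f : A →+* B) (p q : Fin 6 → A) (n : ℕ) :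
    f (sexticCoeff p q n) = sexticCoeff (fun j => f (p j)) (fun j => f (q j)) n := by
  have h : ∀ (a b : A) (k : ℕ → A) (n : ℕ),
      f (mulLin a b k n) = mulLin (f a) (f b) (fun i => f (k i)) n := by
    intro a b k n
    cases n <;> simp [mulLin]
  simp only [sexticCoeff, h, apply_ite f, map_one, map_zero]

end NormalForm

theorem exists_sq_root (a : ℂ) : ∃ b : ℂ, b ^ 2 = a :=
  IsAlgClosed.exists_pow_nat_eq a (by norm_num)

theorem evenPart_sq_sub (p q : Fin 6 → ℂ) (X Y : ℂ) :
    evenPart p q X Y ^ 2 - X * Y * oddPart p q X Y ^ 2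
      = ∏ j, (q j ^ 2 * X - p j ^ 2 * Y) := by
  obtain ⟨U, rfl⟩ := exists_sq_root X
  obtain ⟨V, rfl⟩ := exists_sq_root Y
  have h1 := evenPart_add_oddPart p q U V
  have h2 := evenPart_sub_oddPart p q U V
  calc _ = (evenPart p q (U ^ 2) (V ^ 2) + U * V * oddPart p q (U ^ 2) (V ^ 2)) *
        (evenPart p q (U ^ 2) (V ^ 2) - U * V * oddPart p q (U ^ 2) (V ^ 2)) := by ring
    _ = _ := by
      rw [h1, h2, ← Finset.prod_mul_distrib]
      exact Finset.prod_congr rfl fun j _ => by ring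

/-- Two continuous functions agreeing off the coordinate axes agree. -/
theorem eq_of_eq_off_axes {f g : ℂ → ℂ → ℂ} (hf : Continuous fun x : ℂ × ℂ => f x.1 x.2)
    (hg : Continuous fun x : ℂ × ℂ => g x.1 x.2)
    (h : ∀ X Y : ℂ, X * Y ≠ 0 → f X Y = g X Y) (X Y : ℂ) : f X Y = g X Y := by
  have hd : Dense {x : ℂ × ℂ | x.1 * x.2 ≠ 0} := by
    have : {x : ℂ × ℂ | x.1 * x.2 ≠ 0} = ({0}ᶜ : Set ℂ) ×ˢ ({0}ᶜ : Set ℂ) := by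
      ext x; simp
    rw [this]
    exact (dense_compl_singleton 0).prod (dense_compl_singleton 0)
  have := hf.ext_on hd hg (fun x hx => h x.1 x.2 hx)
  exact congrFun this (X, Y)

/-- A polynomial of degree less than `n` with `n` distinct roots has zero coefficients. -/
theorem coeff_eq_zero_of_roots {n : ℕ} (c : ℕ → ℂ) (e : Fin n → ℂ) (he : Function.Injective e)
    (h : ∀ j, ∑ i ∈ Finset.range n, c i * e j ^ i = 0) : ∀ i < n, c i = 0 := by
  intro i hi
  have hP : (∑ i ∈ Finset.range n, Polynomial.C (c i) * Polynomial.X ^ i) = 0 := by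
    rcases Nat.eq_zero_or_pos n with rfl | hn
    · simp
    refine Polynomial.eq_zero_of_natDegree_lt_card_of_eval_eq_zero _ he (fun j => ?_) ?_
    · simpa [Polynomial.eval_finsetSum] using h j
    · rw [Fintype.card_fin]
      refine (Polynomial.natDegree_sum_le_of_forall_le (n := n - 1) _ _ fun i hi => ?_).trans_lt
        (by omega)
      refine (Polynomial.natDegree_C_mul_X_pow_le _ _).trans ?_
      have := Finset.mem_range.1 hi
      omega
  have := congrArg (fun P => Polynomial.coeff P i) hP
  simpa [Polynomial.finsetSum_coeff, Polynomial.coeff_C_mul, Polynomial.coeff_X_pow, hi] using this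

/-- A sextic vanishing at six distinct points is determined by its leading coefficient. -/
theorem sextic_of_roots (c : ℕ → ℂ) (e : Fin 6 → ℂ) (he : Function.Injective e)
    (h : ∀ j, c 0 * e j ^ 6 + c 1 * e j ^ 5 + c 2 * e j ^ 4 + c 3 * e j ^ 3 + c 4 * e j ^ 2
      + c 5 * e j + c 6 = 0) : ∀ i ≤ 6, c i = c 0 * sexticCoeff e 1 i := by
  have h0 : sexticCoeff e 1 0 = 1 := by simp [sexticCoeff_zero]
  have key := coeff_eq_zero_of_roots (n := 6) (fun i => c (6 - i) - c 0 * sexticCoeff e 1 (6 - i))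
    e he (fun j => by
      have h1 := sexticCoeff_prod e 1 (e j) 1
      rw [Finset.prod_eq_zero (Finset.mem_univ j) (by simp), h0] at h1
      simp only [Finset.sum_range_succ, Finset.sum_range_zero]
      norm_num
      linear_combination h j - c 0 * h1)
  intro i hi
  rcases Nat.eq_zero_or_pos i with rfl | hi0
  · simp [h0]
  · have := key (6 - i) (by omega)
    rw [show 6 - (6 - i) = i by omega] at this
    exact sub_eq_zero.1 this

theorem sexticCoeff_comp_perm (p q : Fin 6 → ℂ) (σ : Equiv.Perm (Fin 6)) :
    ∀ i ≤ 6, sexticCoeff (p ∘ σ) (q ∘ σ) i = sexticCoeff p q i := by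
  have key := coeff_eq_zero_of_roots (n := 7)
    (fun i => sexticCoeff (p ∘ σ) (q ∘ σ) i - sexticCoeff p q i)
    (fun j => (j : ℂ)) (fun a b hab => by
      apply Fin.ext
      exact_mod_cast (show ((a : ℕ) : ℂ) = (b : ℕ) from hab)) (fun j => by
      have h1 := sexticCoeff_prod p q 1 (j : ℂ)
      have h2 := sexticCoeff_prod (p ∘ σ) (q ∘ σ) 1 (j : ℂ)
      have h3 : ∏ i, ((q ∘ σ) i * 1 - (p ∘ σ) i * (j : ℂ)) = ∏ i, (q i * 1 - p i * (j : ℂ)) :=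
        Equiv.prod_comp σ (fun i => q i * 1 - p i * (j : ℂ))
      simp only [Finset.sum_range_succ, Finset.sum_range_zero]
      linear_combination h2 - h1 + h3)
  intro i hi
  exact sub_eq_zero.1 (key i (by omega))

section BinaryForms

variable {A : Type*} [CommRing A]

def form2 (c : Fin 3 → A) (x y : A) : A := c 0 * x ^ 2 + c 1 * x * y + c 2 * y ^ 2

def form3 (d : Fin 4 → A) (x y : A) : A :=
  d 0 * x ^ 3 + d 1 * x ^ 2 * y + d 2 * x * y ^ 2 + d 3 * y ^ 3

def form4 (e : Fin 5 → A) (x y : A) : A :=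
  e 0 * x ^ 4 + e 1 * x ^ 3 * y + e 2 * x ^ 2 * y ^ 2 + e 3 * x * y ^ 3 + e 4 * y ^ 4

/-- A quartic with a double point at `(0, 0, 1)`. -/
def doubleQuartic (c : Fin 3 → A) (d : Fin 4 → A) (e : Fin 5 → A) (x y z : A) : A :=
  form2 c x y * z ^ 2 + form3 d x y * z + form4 e x y

/-- The form cutting out the tangents through the double point of `doubleQuartic`. -/
def tangentForm (c : Fin 3 → A) (d : Fin 4 → A) (e : Fin 5 → A) (x y : A) : A :=
  form3 d x y ^ 2 - 4 * form2 c x y * form4 e x y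

end BinaryForms

/-- The restriction of the quartic to the line `z = a x + b y` is a square. -/
def SqLine (f : ℂ → ℂ → ℂ → ℂ) (a b : ℂ) : Prop :=
  ∃ m₀ m₁ m₂ : ℂ, ∀ s t : ℂ, f s t (a * s + b * t) = (m₀ * s ^ 2 + m₁ * s * t + m₂ * t ^ 2) ^ 2

theorem tangentForm_nodalQuartic (p q : Fin 6 → ℂ) (x y : ℂ) :
    (2 * evenPart p q x y) ^ 2 - 4 * (x * y) * oddPart p q x y ^ 2
      = 4 * ∏ j, (q j ^ 2 * x - p j ^ 2 * y) := by
  rw [← evenPart_sq_sub]; ring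

/-- Square roots with a prescribed sign of the product. -/
theorem exists_sq_roots_prod (a : Fin 6 → ℂ) (r : ℂ) (h : r ^ 2 = 4 * ∏ j, a j) :
    ∃ q : Fin 6 → ℂ, (∀ j, q j ^ 2 = a j) ∧ r = 2 * ∏ j, q j := by
  choose q hq using fun j => exists_sq_root (a j)
  have h1 : r ^ 2 = (2 * ∏ j, q j) ^ 2 := by
    rw [h, mul_pow, ← Finset.prod_pow]
    simp only [hq]; norm_num
  rcases sq_eq_sq_iff_eq_or_eq_neg.1 h1 with h2 | h2
  · exact ⟨q, hq, h2⟩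
  · refine ⟨fun j => if j = 0 then - q 0 else q j, fun j => ?_, ?_⟩
    · rcases eq_or_ne j 0 with rfl | hj
      · simp [hq]
      · simp [hj, hq]
    · rw [h2]
      simp [Fin.prod_univ_six]

theorem nodal_normal_form (p q : Fin 6 → ℂ) (d : Fin 4 → ℂ) (e : Fin 5 → ℂ)
    (hD : ∀ X Y, form3 d X Y ^ 2 - 4 * (X * Y) * form4 e X Y
      = 4 * ∏ j, (q j ^ 2 * X - p j ^ 2 * Y))
    (h0 : d 0 = 2 * ∏ j, q j) (h3 : d 3 = 2 * ∏ j, p j) (X Y z : ℂ) :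
    X * Y * z ^ 2 + form3 d X Y * z + form4 e X Y
      = nodalQuartic p q X Y (z - ((2 * sexticCoeff p q 2 - d 1) / 2 * X
          + (2 * sexticCoeff p q 4 - d 2) / 2 * Y)) := by
  refine eq_of_eq_off_axes (f := fun X Y => X * Y * z ^ 2 + form3 d X Y * z + form4 e X Y)
    (g := fun X Y => nodalQuartic p q X Y (z - ((2 * sexticCoeff p q 2 - d 1) / 2 * X
          + (2 * sexticCoeff p q 4 - d 2) / 2 * Y))) ?_ ?_ ?_ X Y
  · simp only [form3, form4]; fun_prop
  · simp only [nodalQuartic, evenPart, oddPart]; fun_prop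
  · intro X Y hXY
    have h1 := hD X Y
    rw [← evenPart_sq_sub] at h1
    have h2 : form3 d X Y = 2 * evenPart p q X Y - 2 * (X * Y) *
        ((2 * sexticCoeff p q 2 - d 1) / 2 * X + (2 * sexticCoeff p q 4 - d 2) / 2 * Y) := by
      rw [form3, h0, h3, evenPart, sexticCoeff_zero, sexticCoeff_six]
      ring
    apply mul_left_cancel₀ hXY
    simp only [nodalQuartic]
    rw [h2] at h1 ⊢
    linear_combination (-1/4) * h1

/-- Restricting `tangentForm` to the zeros of the tangent cone at the node. -/
theorem exists_nodal_normal_form (d : Fin 4 → ℂ) (e : Fin 5 → ℂ) (P Q : Fin 6 → ℂ)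
    (hD : ∀ X Y, form3 d X Y ^ 2 - 4 * (X * Y) * form4 e X Y
      = 4 * ∏ j, (Q j * X - P j * Y)) :
    ∃ p q : Fin 6 → ℂ, ∃ a b : ℂ, (∀ j, p j ^ 2 = P j) ∧ (∀ j, q j ^ 2 = Q j) ∧
      ∀ X Y z, X * Y * z ^ 2 + form3 d X Y * z + form4 e X Y
        = nodalQuartic p q X Y (z - (a * X + b * Y)) := by
  obtain ⟨q, hq, hq0⟩ := exists_sq_roots_prod Q (d 0) (by
    simpa [form3] using hD 1 0)
  obtain ⟨p, hp, hp0⟩ := exists_sq_roots_prod P (d 3) (by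
    have := hD 0 1
    simp only [form3, Fin.prod_univ_six] at this ⊢
    linear_combination this)
  exact ⟨p, q, _, _, hp, hq, nodal_normal_form p q d e (fun X Y => by
    rw [hD]; simp [hp, hq]) hq0 hp0⟩

section Signs

variable {A : Type*} [CommRing A]

def boolSign (b : Bool) : A := if b then -1 else 1

@[simp]
theorem boolSign_sq (b : Bool) : (boolSign b : A) ^ 2 = 1 := by
  cases b <;> simp [boolSign]

/-- Change the signs of the last five coordinates. -/
def flipSigns (b : Fin 5 → Bool) (u : Fin 6 → A) : Fin 6 → A :=
  Fin.cons (u 0) (fun j => boolSign (b j) * u j.succ)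

@[simp]
theorem flipSigns_zero (b : Fin 5 → Bool) (u : Fin 6 → A) : flipSigns b u 0 = u 0 := rfl

@[simp]
theorem flipSigns_succ (b : Fin 5 → Bool) (u : Fin 6 → A) (j : Fin 5) :
    flipSigns b u j.succ = boolSign (b j) * u j.succ := rfl

theorem flipSigns_sq (b : Fin 5 → Bool) (u : Fin 6 → A) (j : Fin 6) :
    flipSigns b u j ^ 2 = u j ^ 2 := by
  refine Fin.cases ?_ (fun j => ?_) j
  · simp
  · simp [mul_pow]

/-- The product `∏ (u 0 ± u j)` over `j ≠ 0`. -/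
def signProd (b : Fin 5 → Bool) (u : Fin 6 → A) : A :=
  ∏ j : Fin 5, (u 0 + boolSign (b j) * u j.succ)

end Signs

/-- The even part, evaluated at one of the roots of the sextic. -/
theorem evenPart_root (p q : Fin 6 → ℂ) :
    evenPart p q (p 0 ^ 2) (q 0 ^ 2)
      = p 0 * q 0 * ∏ j : Fin 5, (q j.succ * p 0 + p j.succ * q 0) := by
  have h1 := evenPart_add_oddPart p q (p 0) (q 0)
  have h2 := evenPart_sub_oddPart p q (p 0) (q 0)
  rw [Fin.prod_univ_succ] at h1 h2
  linear_combination (1/2) * h1 + (1/2) * h2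

theorem evenPart_sub_of_sq {p p' q : Fin 6 → ℂ}
    (h6 : sexticCoeff p' q 6 = sexticCoeff p q 6) (X Y : ℂ) :
    evenPart p' q X Y = evenPart p q X Y
      + X * Y * ((sexticCoeff p' q 2 - sexticCoeff p q 2) * X
        + (sexticCoeff p' q 4 - sexticCoeff p q 4) * Y) := by
  rw [evenPart, evenPart, h6, sexticCoeff_zero, sexticCoeff_zero]
  ring

/-- The tropes of the nodal quartic: each even choice of signs gives a tangent line. -/
theorem nodalQuartic_line {p p' q : Fin 6 → ℂ} (hp : ∀ j, p' j ^ 2 = p j ^ 2)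
    (h6 : sexticCoeff p' q 6 = sexticCoeff p q 6) (X Y : ℂ) :
    nodalQuartic p q X Y ((sexticCoeff p' q 2 - sexticCoeff p q 2) * X
        + (sexticCoeff p' q 4 - sexticCoeff p q 4) * Y) = oddPart p' q X Y ^ 2 := by
  refine eq_of_eq_off_axes (f := fun X Y => nodalQuartic p q X Y
      ((sexticCoeff p' q 2 - sexticCoeff p q 2) * X
        + (sexticCoeff p' q 4 - sexticCoeff p q 4) * Y))
    (g := fun X Y => oddPart p' q X Y ^ 2) ?_ ?_ ?_ X Y
  · simp only [nodalQuartic, evenPart, oddPart]; fun_prop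
  · simp only [oddPart]; fun_prop
  · intro X Y hXY
    have h1 := evenPart_sq_sub p q X Y
    have h2 := evenPart_sq_sub p' q X Y
    simp only [hp, ← h1] at h2
    rw [evenPart_sub_of_sq h6] at h2
    apply mul_left_cancel₀ hXY
    simp only [nodalQuartic]
    linear_combination h2

/-- Every tangent line of a nodal quartic comes from a choice of signs. -/
theorem exists_signs_of_sqLine {u : Fin 6 → ℂ}
    (hinj : Function.Injective fun j => u j ^ 2) {a b : ℂ}
    (h : SqLine (nodalQuartic u 1) a b) :
    ∃ s : Fin 5 → Bool,
      a = sexticCoeff (flipSigns s u) 1 2 - sexticCoeff u 1 2 ∧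
      b = sexticCoeff (flipSigns s u) 1 4 - sexticCoeff u 1 4 ∧
      sexticCoeff (flipSigns s u) 1 6 = sexticCoeff u 1 6 := by
  obtain ⟨m₀, m₁, m₂, hm⟩ := h
  have hsq : ∀ j, (u j ^ 2 * (a * u j ^ 2 + b) + evenPart u 1 (u j ^ 2) 1) ^ 2
      = (u j * (m₀ * u j ^ 4 + m₁ * u j ^ 2 + m₂)) ^ 2 := by
    intro j
    have h1 := evenPart_sq_sub u 1 (u j ^ 2) 1
    rw [Finset.prod_eq_zero (Finset.mem_univ j) (by simp)] at h1
    have h2 := hm (u j ^ 2) 1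
    rw [nodalQuartic] at h2
    linear_combination h1 + u j ^ 2 * h2
  obtain ⟨m₀, m₁, m₂, hsq, h0⟩ : ∃ m₀ m₁ m₂ : ℂ,
      (∀ j, (u j ^ 2 * (a * u j ^ 2 + b) + evenPart u 1 (u j ^ 2) 1) ^ 2
        = (u j * (m₀ * u j ^ 4 + m₁ * u j ^ 2 + m₂)) ^ 2) ∧
      u 0 ^ 2 * (a * u 0 ^ 2 + b) + evenPart u 1 (u 0 ^ 2) 1
        = - (u 0 * (m₀ * u 0 ^ 4 + m₁ * u 0 ^ 2 + m₂)) := by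
    rcases sq_eq_sq_iff_eq_or_eq_neg.1 (hsq 0) with h | h
    · exact ⟨-m₀, -m₁, -m₂, fun j => by rw [hsq]; ring, by rw [h]; ring⟩
    · exact ⟨m₀, m₁, m₂, hsq, h⟩
  have hs : ∀ j : Fin 5, ∃ t : Bool,
      u j.succ ^ 2 * (a * u j.succ ^ 2 + b) + evenPart u 1 (u j.succ ^ 2) 1
        = - (boolSign t * u j.succ * (m₀ * u j.succ ^ 4 + m₁ * u j.succ ^ 2 + m₂)) := by
    intro j
    rcases sq_eq_sq_iff_eq_or_eq_neg.1 (hsq j.succ) with h | h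
    · exact ⟨true, by rw [h]; simp [boolSign]⟩
    · exact ⟨false, by rw [h]; simp [boolSign]⟩
  choose s hs using hs
  have hroot : ∀ j, u j ^ 2 * (a * u j ^ 2 + b) + evenPart u 1 (u j ^ 2) 1
      = - (flipSigns s u j * (m₀ * u j ^ 4 + m₁ * u j ^ 2 + m₂)) := by
    intro j
    refine Fin.cases ?_ (fun j => ?_) j
    · rw [h0]; simp
    · rw [hs]; simp
  have hk0 : sexticCoeff u 1 0 = 1 := by simp [sexticCoeff_zero]
  have key := sextic_of_roots (fun i => match i with
    | 0 => 1 | 1 => m₀ | 2 => a + sexticCoeff u 1 2 | 3 => m₁ | 4 => b + sexticCoeff u 1 4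
    | 5 => m₂ | _ => sexticCoeff u 1 6) (flipSigns s u)
    (fun i j hij => hinj (by
      change u i ^ 2 = u j ^ 2
      rw [← flipSigns_sq s u i, ← flipSigns_sq s u j, hij])) (fun j => by
      have h1 := flipSigns_sq s u j
      have h2 := hroot j
      rw [← h1] at h2
      have h4 : u j ^ 4 = flipSigns s u j ^ 4 := by
        linear_combination (-(u j ^ 2) - flipSigns s u j ^ 2) * h1
      rw [h4, evenPart, hk0] at h2
      simp only
      linear_combination h2)
  refine ⟨s, ?_, ?_, ?_⟩
  · have := key 2 (by norm_num); simp only at this; linear_combination this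
  · have := key 4 (by norm_num); simp only at this; linear_combination this
  · have := key 6 (by norm_num); simp only at this; linear_combination -this

/-- The height of a tangent line over the first tangent through the node. -/
theorem line_height {u : Fin 6 → ℂ} {s : Fin 5 → Bool} {a b : ℂ}
    (ha : a = sexticCoeff (flipSigns s u) 1 2 - sexticCoeff u 1 2)
    (hb : b = sexticCoeff (flipSigns s u) 1 4 - sexticCoeff u 1 4)
    (h6 : sexticCoeff (flipSigns s u) 1 6 = sexticCoeff u 1 6) :
    u 0 ^ 2 * (a * u 0 ^ 2 + b) = u 0 * signProd s u - evenPart u 1 (u 0 ^ 2) 1 := by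
  have h1 := evenPart_root (flipSigns s u) 1
  rw [evenPart_sub_of_sq h6] at h1
  simp only [flipSigns_zero, Pi.one_apply, one_pow, mul_one, flipSigns_succ, one_mul,
    ← ha, ← hb] at h1
  rw [signProd]
  linear_combination h1

/-- Quadratic forms with the same square agree up to sign. -/
theorem form2_eq_or_neg {c c' : Fin 3 → ℂ}
    (h : ∀ x y, form2 c x y ^ 2 = form2 c' x y ^ 2) :
    (∀ x y, form2 c x y = form2 c' x y) ∨ (∀ x y, form2 c x y = - form2 c' x y) := by
  let P : (Fin 3 → ℂ) → Polynomial ℂ := fun c => Polynomial.C (c 0) * Polynomial.X ^ 2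
    + Polynomial.C (c 1) * Polynomial.X + Polynomial.C (c 2)
  have hc : ∀ c : Fin 3 → ℂ, P c = 0 → c 0 = 0 ∧ c 1 = 0 ∧ c 2 = 0 := by
    intro c hc
    have h0 := congrArg (Polynomial.eval 0) hc
    have h1 := congrArg (Polynomial.eval 1) hc
    have h2 := congrArg (Polynomial.eval (-1)) hc
    simp [P] at h0 h1 h2
    refine ⟨?_, ?_, h0⟩
    · linear_combination (1/2) * h1 + (1/2) * h2 - h0
    · linear_combination (1/2) * h1 - (1/2) * h2
  have hmul : P (c - c') * P (c + c') = 0 := by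
    refine Polynomial.funext fun x => ?_
    have := h x 1
    simp only [form2] at this
    simp [P, -mul_eq_zero]
    linear_combination this
  rcases mul_eq_zero.1 hmul with h1 | h1
  · obtain ⟨h0, h1, h2⟩ := hc _ h1
    simp only [Pi.sub_apply] at h0 h1 h2
    left; intro x y
    simp only [form2]
    linear_combination x ^ 2 * h0 + x * y * h1 + y ^ 2 * h2
  · obtain ⟨h0, h1, h2⟩ := hc _ h1
    simp only [Pi.add_apply] at h0 h1 h2
    right; intro x y
    simp only [form2]
    linear_combination x ^ 2 * h0 + x * y * h1 + y ^ 2 * h2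

theorem boolSign_injective : Function.Injective (boolSign : Bool → ℂ) := by
  intro a b
  cases a <;> cases b <;> norm_num [boolSign]

/-- An even sign choice is determined by its even part. -/
theorem signs_eq_of_evenPart {p q : Fin 6 → ℂ} {s s' : Fin 5 → Bool}
    (h0 : p 0 * q 0 ≠ 0)
    (hne : ∀ i j, i ≠ j → p i ^ 2 * q j ^ 2 ≠ p j ^ 2 * q i ^ 2)
    (hs : ∏ j, (boolSign (s j) : ℂ) = 1) (hs' : ∏ j, (boolSign (s' j) : ℂ) = 1)
    (hE : ∀ X Y, evenPart (flipSigns s p) q X Y = evenPart (flipSigns s' p) q X Y) :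
    s = s' := by
  have hnz : ∀ (s : Fin 5 → Bool) (j : Fin 5),
      q j.succ * p 0 + boolSign (s j) * p j.succ * q 0 ≠ 0 := by
    intro s j hj
    refine hne 0 j.succ (Fin.succ_ne_zero j).symm ?_
    have := boolSign_sq (A := ℂ) (s j)
    linear_combination (q j.succ * p 0 - boolSign (s j) * p j.succ * q 0) * hj
      + p j.succ ^ 2 * q 0 ^ 2 * this
  have hO : ∀ X Y, oddPart (flipSigns s p) q X Y ^ 2 = oddPart (flipSigns s' p) q X Y ^ 2 := by
    refine eq_of_eq_off_axes ?_ ?_ ?_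
    · simp only [oddPart]; fun_prop
    · simp only [oddPart]; fun_prop
    · intro X Y hXY
      have h1 := evenPart_sq_sub (flipSigns s p) q X Y
      have h2 := evenPart_sq_sub (flipSigns s' p) q X Y
      simp only [flipSigns_sq] at h1 h2
      rw [hE] at h1
      apply mul_left_cancel₀ hXY
      linear_combination h2 - h1
  have hO' := form2_eq_or_neg (c := fun i => sexticCoeff (flipSigns s p) q (2 * i + 1))
    (c' := fun i => sexticCoeff (flipSigns s' p) q (2 * i + 1)) (fun x y => by
      have := hO x y
      simpa [form2, oddPart] using this)
  have hfac : ∀ (s : Fin 5 → Bool) (U V : ℂ), evenPart (flipSigns s p) q (U ^ 2) (V ^ 2)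
      + U * V * oddPart (flipSigns s p) q (U ^ 2) (V ^ 2)
      = (q 0 * U - p 0 * V) * ∏ j : Fin 5, (q j.succ * U - boolSign (s j) * p j.succ * V) := by
    intro s U V
    rw [evenPart_add_oddPart, Fin.prod_univ_succ]
    simp
  rcases hO' with hO' | hO'
  · have hΦ : ∀ U V : ℂ,
        (q 0 * U - p 0 * V) * ∏ j : Fin 5, (q j.succ * U - boolSign (s j) * p j.succ * V)
        = (q 0 * U - p 0 * V) *
          ∏ j : Fin 5, (q j.succ * U - boolSign (s' j) * p j.succ * V) := by
      intro U V
      rw [← hfac, ← hfac, hE]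
      have := hO' (U ^ 2) (V ^ 2)
      simp only [form2] at this
      norm_num at this
      rw [oddPart, oddPart, this]
    have hgen : ∀ k : Fin 5, p k.succ * q k.succ ≠ 0 → s k = s' k := by
      intro k hk
      have h1 := hΦ (boolSign (s k) * p k.succ) (q k.succ)
      have hsk := boolSign_sq (A := ℂ) (s k)
      rw [Finset.prod_eq_zero (Finset.mem_univ k) (by ring), mul_zero] at h1
      rcases mul_eq_zero.1 h1.symm with h1 | h1
      · exfalso
        refine hne k.succ 0 (Fin.succ_ne_zero k) ?_
        linear_combination (q 0 * (boolSign (s k) * p k.succ) + p 0 * q k.succ) * h1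
          - q 0 ^ 2 * p k.succ ^ 2 * hsk
      · obtain ⟨j, -, hj⟩ := Finset.prod_eq_zero_iff.1 h1
        have hsj := boolSign_sq (A := ℂ) (s' j)
        have hjk : j = k := by
          by_contra hjk
          refine hne k.succ j.succ (fun h => hjk (Fin.succ_injective _ h).symm) ?_
          linear_combination (q j.succ * (boolSign (s k) * p k.succ)
            + boolSign (s' j) * p j.succ * q k.succ) * hj - q j.succ ^ 2 * p k.succ ^ 2 * hsk
            + p j.succ ^ 2 * q k.succ ^ 2 * hsj
        subst hjk
        apply boolSign_injective
        apply mul_left_cancel₀ hk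
        linear_combination hj
    have hp : ∀ k : Fin 5, p k.succ ≠ 0 → s k = s' k := by
      intro k hk
      by_cases hq : q k.succ = 0
      · have h1 := hΦ (p 0) (-q 0)
        have h2 : q 0 * p 0 - p 0 * -q 0 ≠ 0 := by
          intro h; apply h0; linear_combination h / 2
        have h3 := mul_left_cancel₀ h2 h1
        rw [← Finset.mul_prod_erase _ _ (Finset.mem_univ k),
          ← Finset.mul_prod_erase _ _ (Finset.mem_univ k)] at h3
        have h4 : ∀ j ∈ Finset.univ.erase k,
            q j.succ * p 0 - boolSign (s j) * p j.succ * -q 0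
            = q j.succ * p 0 - boolSign (s' j) * p j.succ * -q 0 := by
          intro j hj
          have hjk := Finset.ne_of_mem_erase hj
          by_cases hpj : p j.succ = 0
          · simp [hpj]
          · rw [hgen j (mul_ne_zero hpj fun hqj => ?_)]
            exact hne k.succ j.succ (fun h => hjk (Fin.succ_injective _ h).symm)
              (by rw [hq, hqj]; ring)
        rw [Finset.prod_congr rfl h4] at h3
        have h5 : ∏ j ∈ Finset.univ.erase k,
            (q j.succ * p 0 - boolSign (s' j) * p j.succ * -q 0) ≠ 0 := by
          refine Finset.prod_ne_zero_iff.2 fun j _ h => hnz s' j ?_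
          linear_combination h
        have h6 := mul_right_cancel₀ h5 h3
        rw [hq] at h6
        apply boolSign_injective
        have hq0 : q 0 ≠ 0 := right_ne_zero_of_mul h0
        apply mul_left_cancel₀ (mul_ne_zero hk hq0)
        linear_combination h6
      · exact hgen k (mul_ne_zero hk hq)
    funext k
    by_cases hk : p k.succ = 0
    · rw [← hs', ← Finset.mul_prod_erase _ _ (Finset.mem_univ k),
        ← Finset.mul_prod_erase _ _ (Finset.mem_univ k)] at hs
      have h4 : ∀ j ∈ Finset.univ.erase k, (boolSign (s j) : ℂ) = boolSign (s' j) := by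
        intro j hj
        have hjk := Finset.ne_of_mem_erase hj
        rw [hp j fun hpj => ?_]
        exact hne k.succ j.succ (fun h => hjk (Fin.succ_injective _ h).symm)
          (by rw [hk, hpj]; ring)
      rw [Finset.prod_congr rfl h4] at hs
      refine boolSign_injective (mul_right_cancel₀ (Finset.prod_ne_zero_iff.2 fun j _ h => ?_) hs)
      have := boolSign_sq (A := ℂ) (s' j)
      rw [h] at this
      norm_num at this
    · exact hp k hk
  · exfalso
    have h1 := hfac s (p 0) (q 0)
    have h2 := hfac s' (p 0) (-q 0)
    have h3 := hO' (p 0 ^ 2) (q 0 ^ 2)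
    simp only [form2] at h3
    norm_num at h3
    rw [oddPart, h3, hE] at h1
    rw [neg_sq, oddPart] at h2
    have h5 : ∏ j : Fin 5, (q j.succ * p 0 - boolSign (s' j) * p j.succ * -q 0) ≠ 0 := by
      refine Finset.prod_ne_zero_iff.2 fun j _ h => hnz s' j ?_
      linear_combination h
    apply mul_ne_zero h0 h5
    linear_combination (-1/2) * h2 + (1/2) * h1

theorem map_signProd {A B : Type*} [CommRing A] [CommRing B] (f : A →+* B) (b : Fin 5 → Bool)
    (u : Fin 6 → A) : f (signProd b u) = signProd b (fun j => f (u j)) := by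
  have h : ∀ t : Bool, f (boolSign t) = boolSign t := by
    intro t; cases t <;> simp [boolSign]
  simp [signProd, map_prod, h]

/-- The polynomial `f` vanishes to order exactly `n` at `0`. -/
def HasOrd (f : Polynomial ℂ) (n : ℕ) : Prop :=
  ∃ h : Polynomial ℂ, f = Polynomial.X ^ n * h ∧ h.eval 0 ≠ 0

namespace HasOrd

theorem ne_zero {f : Polynomial ℂ} {n : ℕ} (hf : HasOrd f n) : f ≠ 0 := by
  obtain ⟨h, rfl, h0⟩ := hf
  refine mul_ne_zero (pow_ne_zero _ Polynomial.X_ne_zero) ?_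
  rintro rfl
  simp at h0

theorem mul {f g : Polynomial ℂ} {m n : ℕ} (hf : HasOrd f m) (hg : HasOrd g n) :
    HasOrd (f * g) (m + n) := by
  obtain ⟨h, rfl, h0⟩ := hf
  obtain ⟨k, rfl, k0⟩ := hg
  exact ⟨h * k, by ring, by simpa using ⟨h0, k0⟩⟩

theorem neg {f : Polynomial ℂ} {m : ℕ} (hf : HasOrd f m) : HasOrd (-f) m := by
  obtain ⟨h, rfl, h0⟩ := hf
  exact ⟨-h, by ring, by simpa using h0⟩

theorem add_of_lt {f g : Polynomial ℂ} {m n : ℕ} (hf : HasOrd f m) (hg : HasOrd g n)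
    (hmn : m < n) : HasOrd (f + g) m := by
  obtain ⟨h, rfl, h0⟩ := hf
  obtain ⟨k, rfl, k0⟩ := hg
  obtain ⟨d, rfl⟩ := Nat.exists_eq_add_of_lt hmn
  refine ⟨h + Polynomial.X ^ (d + 1) * k, by ring, by simpa using h0⟩

theorem add {f g : Polynomial ℂ} {m n : ℕ} (hf : HasOrd f m) (hg : HasOrd g n)
    (hmn : m ≠ n) : HasOrd (f + g) (min m n) := by
  rcases lt_or_gt_of_ne hmn with h | h
  · rw [min_eq_left h.le]; exact hf.add_of_lt hg h
  · rw [min_eq_right h.le, add_comm]; exact hg.add_of_lt hf h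

theorem sub {f g : Polynomial ℂ} {m n : ℕ} (hf : HasOrd f m) (hg : HasOrd g n)
    (hmn : m ≠ n) : HasOrd (f - g) (min m n) := by
  rw [sub_eq_add_neg]; exact hf.add hg.neg hmn

theorem unique {f : Polynomial ℂ} {m n : ℕ} (hf : HasOrd f m) (hg : HasOrd f n) : m = n := by
  by_contra hmn
  have := hf.sub hg hmn
  rw [sub_self] at this
  exact this.ne_zero rfl

theorem prod {ι : Type*} (s : Finset ι) (f : ι → Polynomial ℂ) (n : ι → ℕ)
    (h : ∀ i, HasOrd (f i) (n i)) : HasOrd (∏ i ∈ s, f i) (∑ i ∈ s, n i) := by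
  classical
  induction s using Finset.induction_on with
  | empty => exact ⟨1, by simp, by simp⟩
  | insert a s ha ih => rw [Finset.prod_insert ha, Finset.sum_insert ha]; exact (h a).mul ih

end HasOrd

/-- The order of vanishing of `signProd b` at the test point below. -/
def signWeight (b : Fin 5 → Bool) : ℕ := ∑ j : Fin 5, if b j then 0 else 3 ^ (j : ℕ)

/-- The curve `u 0 = 1`, `u (j + 1) = t ^ (3 ^ j) - 1`. -/
def testPoint : Fin 6 → Polynomial ℂ :=
  Fin.cons 1 (fun j : Fin 5 => Polynomial.X ^ (3 ^ (j : ℕ)) - 1)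

theorem hasOrd_signProd (b : Fin 5 → Bool) : HasOrd (signProd b testPoint) (signWeight b) := by
  refine HasOrd.prod _ _ _ fun j => ?_
  cases b j
  · exact ⟨1, by simp [testPoint, boolSign], by simp⟩
  · refine ⟨2 - Polynomial.X ^ (3 ^ (j : ℕ)), ?_, ?_⟩
    · simp [testPoint, boolSign]; ring
    · simp

theorem digits_unique {a0 a1 a2 a3 a4 b0 b1 b2 b3 b4 : ℕ}
    (h0 : a0 ≤ 2) (h1 : a1 ≤ 2) (h2 : a2 ≤ 2) (h3 : a3 ≤ 2)
    (k0 : b0 ≤ 2) (k1 : b1 ≤ 2) (k2 : b2 ≤ 2) (k3 : b3 ≤ 2)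
    (h : a0 + 3 * a1 + 9 * a2 + 27 * a3 + 81 * a4 = b0 + 3 * b1 + 9 * b2 + 27 * b3 + 81 * b4) :
    a0 = b0 ∧ a1 = b1 ∧ a2 = b2 ∧ a3 = b3 ∧ a4 = b4 := by
  have e0 : a0 = b0 := by omega
  have e1 : a1 = b1 := by omega
  have e2 : a2 = b2 := by omega
  omega

def boolDigit (b : Bool) : ℕ := if b then 0 else 1

theorem boolDigit_le (b : Bool) : boolDigit b ≤ 1 := by cases b <;> simp [boolDigit]

theorem signWeight_eq (b : Fin 5 → Bool) : signWeight b = boolDigit (b 0) + 3 * boolDigit (b 1)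
    + 9 * boolDigit (b 2) + 27 * boolDigit (b 3) + 81 * boolDigit (b 4) := by
  simp only [signWeight, Fin.sum_univ_five, boolDigit]
  cases b 0 <;> cases b 1 <;> cases b 2 <;> cases b 3 <;> cases b 4 <;> rfl

theorem digit_sum_of_signWeight {b c b' c' : Fin 5 → Bool}
    (h : signWeight b + signWeight c = signWeight b' + signWeight c') (j : Fin 5) :
    boolDigit (b j) + boolDigit (c j) = boolDigit (b' j) + boolDigit (c' j) := by
  simp only [signWeight_eq] at h
  have hb := fun j => boolDigit_le (b j)
  have hc := fun j => boolDigit_le (c j)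
  have hb' := fun j => boolDigit_le (b' j)
  have hc' := fun j => boolDigit_le (c' j)
  obtain ⟨h0, h1, h2, h3, h4⟩ := digits_unique (a4 := boolDigit (b 4) + boolDigit (c 4))
    (b4 := boolDigit (b' 4) + boolDigit (c' 4)) (add_le_add (hb 0) (hc 0)) (add_le_add (hb 1) (hc 1)) (add_le_add (hb 2) (hc 2))
    (add_le_add (hb 3) (hc 3))
    (add_le_add (hb' 0) (hc' 0)) (add_le_add (hb' 1) (hc' 1)) (add_le_add (hb' 2) (hc' 2))
    (add_le_add (hb' 3) (hc' 3)) (by linarith)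
  fin_cases j <;> assumption

theorem signWeight_injective : Function.Injective signWeight := by
  intro b c h
  funext j
  have := digit_sum_of_signWeight (b := b) (c := b) (b' := c) (c' := c) (by rw [h]) j
  revert this
  cases b j <;> cases c j <;> simp [boolDigit]

theorem signProd_mul_eq {A : Type*} [CommRing A] {b c b' c' : Fin 5 → Bool}
    (h : signWeight b + signWeight c = signWeight b' + signWeight c') (u : Fin 6 → A) :
    signProd b u * signProd c u = signProd b' u * signProd c' u := by
  simp only [signProd, ← Finset.prod_mul_distrib]
  refine Finset.prod_congr rfl fun j _ => ?_
  have := digit_sum_of_signWeight h j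
  revert this
  cases b j <;> cases c j <;> cases b' j <;> cases c' j <;> simp [boolDigit, boolSign] <;> ring

theorem mem_of_min_sub {a a' b b' c c' : ℕ} {d : ℤ}
    (e1 : ((min (a + a') (b + b') : ℕ) : ℤ) = (min (min a a') (min b b') : ℕ) + d)
    (e2 : ((min (a + a') (c + c') : ℕ) : ℤ) = (min (min a a') (min c c') : ℕ) + d)
    (e3 : ((min (b + b') (c + c') : ℕ) : ℤ) = (min (min b b') (min c c') : ℕ) + d) :
    d = a ∨ d = a' ∨ d = b ∨ d = b' ∨ d = c ∨ d = c' := by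
  omega

/-- For three pairs of sign products in each of two groups, the relations
`(T - z) (T' - z) = K` within each group generically force `z = 0`. -/
theorem exists_poly_of_injective (β : Fin 2 → Fin 3 → Fin 2 → Fin 5 → Bool)
    (hβ : ∀ o k i o' k' i', β o k i = β o' k' i' → o = o' ∧ k = k' ∧ i = i') :
    ∃ R : MvPolynomial (Fin 6) ℂ, R ≠ 0 ∧ ∀ u, eval u R ≠ 0 → ∀ (z : ℂ) (K : Fin 2 → ℂ),
      (∀ o k, (signProd (β o k 0) u - z) * (signProd (β o k 1) u - z) = K o) → z = 0 := by
  let T : Fin 2 → Fin 3 → Fin 2 → MvPolynomial (Fin 6) ℂ := fun o k i => signProd (β o k i) X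
  let p : Fin 2 → Fin 3 → Fin 3 → MvPolynomial (Fin 6) ℂ :=
    fun o k k' => T o k 0 * T o k 1 - T o k' 0 * T o k' 1
  let s : Fin 2 → Fin 3 → Fin 3 → MvPolynomial (Fin 6) ℂ :=
    fun o k k' => (T o k 0 + T o k 1) - (T o k' 0 + T o k' 1)
  have hT : ∀ u o k i, eval u (T o k i) = signProd (β o k i) u := by
    intro u o k i
    simp only [T, map_signProd, eval_X]
  have hrel : ∀ u (z : ℂ) (K : Fin 2 → ℂ),
      (∀ o k, (signProd (β o k 0) u - z) * (signProd (β o k 1) u - z) = K o) →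
      ∀ o k k', eval u (p o k k') = z * eval u (s o k k') := by
    intro u z K h o k k'
    simp only [p, s, map_sub, map_mul, map_add, hT]
    linear_combination h o k - h o k'
  let ψ : MvPolynomial (Fin 6) ℂ →ₐ[ℂ] Polynomial ℂ := aeval testPoint
  let w : Fin 2 → Fin 3 → Fin 2 → ℕ := fun o k i => signWeight (β o k i)
  have hw : ∀ o k i o' k' i', w o k i = w o' k' i' → o = o' ∧ k = k' ∧ i = i' :=
    fun o k i o' k' i' h => hβ _ _ _ _ _ _ (signWeight_injective h)
  have hψ : ∀ o k i, HasOrd (ψ (T o k i)) (w o k i) := by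
    intro o k i
    have : ψ (T o k i) = signProd (β o k i) testPoint := by
      have := map_signProd (ψ : MvPolynomial (Fin 6) ℂ →+* Polynomial ℂ) (β o k i) X
      simpa [ψ, T] using this
    rw [this]
    exact hasOrd_signProd _
  have hs : ∀ o k k', k ≠ k' → HasOrd (ψ (s o k k'))
      (min (min (w o k 0) (w o k 1)) (min (w o k' 0) (w o k' 1))) := by
    intro o k k' hk
    simp only [s, map_sub, map_add]
    have h1 : w o k 0 ≠ w o k 1 := fun h => by simpa using (hw _ _ _ _ _ _ h).2.2
    have h2 : w o k' 0 ≠ w o k' 1 := fun h => by simpa using (hw _ _ _ _ _ _ h).2.2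
    refine ((hψ o k 0).add (hψ o k 1) h1).sub ((hψ o k' 0).add (hψ o k' 1) h2) fun h => hk ?_
    rcases min_choice (w o k 0) (w o k 1) with e | e <;>
      rcases min_choice (w o k' 0) (w o k' 1) with e' | e' <;>
      rw [e, e'] at h <;> exact (hw _ _ _ _ _ _ h).2.1
  by_cases hA : ∃ o k k', k ≠ k' ∧ p o k k' = 0
  · obtain ⟨o, k, k', hk, hp⟩ := hA
    refine ⟨s o k k', fun h => (hs o k k' hk).ne_zero (by rw [h, map_zero]), fun u hu z K h => ?_⟩
    have := hrel u z K h o k k'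
    rw [hp, map_zero] at this
    exact (mul_eq_zero.1 this.symm).resolve_right hu
  push Not at hA
  have hp : ∀ o k k', k ≠ k' → HasOrd (ψ (p o k k'))
      (min (w o k 0 + w o k 1) (w o k' 0 + w o k' 1)) := by
    intro o k k' hk
    simp only [p, map_sub, map_mul]
    refine ((hψ o k 0).mul (hψ o k 1)).sub ((hψ o k' 0).mul (hψ o k' 1)) fun h => hA o k k' hk ?_
    exact sub_eq_zero.2 (signProd_mul_eq h _)
  by_cases hB : ∃ o k k' o' l l', s o k k' * p o' l l' - s o' l l' * p o k k' ≠ 0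
  · obtain ⟨o, k, k', o', l, l', hB⟩ := hB
    refine ⟨_, hB, fun u hu z K h => absurd ?_ hu⟩
    have h1 := hrel u z K h o k k'
    have h2 := hrel u z K h o' l l'
    simp only [map_sub, map_mul, h1, h2]
    ring
  exfalso
  push Not at hB
  have hd : ∀ o k k', k ≠ k' → ((min (w o k 0 + w o k 1) (w o k' 0 + w o k' 1) : ℕ) : ℤ)
      = (min (min (w o k 0) (w o k 1)) (min (w o k' 0) (w o k' 1)) : ℕ)
        + (((min (w 0 0 0 + w 0 0 1) (w 0 1 0 + w 0 1 1) : ℕ) : ℤ)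
        - (min (min (w 0 0 0) (w 0 0 1)) (min (w 0 1 0) (w 0 1 1)) : ℕ)) := by
    intro o k k' hk
    have h1 := sub_eq_zero.1 (hB 0 0 1 o k k')
    have h2 := (hs 0 0 1 (by decide)).mul (hp o k k' hk)
    have h3 := (hs o k k' hk).mul (hp 0 0 1 (by decide))
    rw [← map_mul, h1, map_mul] at h2
    have := h2.unique h3
    omega
  set d := (((min (w 0 0 0 + w 0 0 1) (w 0 1 0 + w 0 1 1) : ℕ) : ℤ)
        - (min (min (w 0 0 0) (w 0 0 1)) (min (w 0 1 0) (w 0 1 1)) : ℕ))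
  have hmem : ∀ o, ∃ k i, d = w o k i := by
    intro o
    rcases mem_of_min_sub (hd o 0 1 (by decide)) (hd o 0 2 (by decide)) (hd o 1 2 (by decide))
      with h | h | h | h | h | h <;> exact ⟨_, _, h⟩
  obtain ⟨k, i, h⟩ := hmem 0
  obtain ⟨k', i', h'⟩ := hmem 1
  have := (hw 0 k i 1 k' i' (by omega)).1
  exact absurd this (by decide)

theorem exists_common_nonvanishing {ι σ : Type*} [Finite ι] (Q : ι → (σ → ℂ) → Prop)
    (h : ∀ i, ∃ R : MvPolynomial σ ℂ, R ≠ 0 ∧ ∀ u, eval u R ≠ 0 → Q i u) :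
    ∃ R : MvPolynomial σ ℂ, R ≠ 0 ∧ ∀ u, eval u R ≠ 0 → ∀ i, Q i u := by
  have := Fintype.ofFinite ι
  choose R hR0 hR using h
  refine ⟨∏ i, R i, Finset.prod_ne_zero_iff.2 fun i _ => hR0 i, fun u hu i => hR i u ?_⟩
  rw [map_prod] at hu
  exact Finset.prod_ne_zero_iff.1 hu i (Finset.mem_univ _)

/-- Generic injectivity of the sign products: see `exists_poly_of_injective`. -/
def SignGeneric (u : Fin 6 → ℂ) : Prop :=
  ∀ β : Fin 2 → Fin 3 → Fin 2 → Fin 5 → Bool,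
    (∀ o k i o' k' i', β o k i = β o' k' i' → o = o' ∧ k = k' ∧ i = i') →
    ∀ (z : ℂ) (K : Fin 2 → ℂ),
      (∀ o k, (signProd (β o k 0) u - z) * (signProd (β o k 1) u - z) = K o) → z = 0

theorem exists_signGeneric :
    ∃ R : MvPolynomial (Fin 6) ℂ, R ≠ 0 ∧ ∀ u, eval u R ≠ 0 → SignGeneric u := by
  refine exists_common_nonvanishing _ fun β => ?_
  by_cases hβ : ∀ o k i o' k' i', β o k i = β o' k' i' → o = o' ∧ k = k' ∧ i = i'
  · obtain ⟨R, hR0, hR⟩ := exists_poly_of_injective β hβ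
    exact ⟨R, hR0, fun u hu _ => hR u hu⟩
  · exact ⟨1, one_ne_zero, fun u _ h => absurd h hβ⟩

/-- The generality condition on the six tangents through the node. -/
def Generic (u : Fin 6 → ℂ) : Prop :=
  (∀ j, u j ≠ 0) ∧ (∀ i j, i ≠ j → u i ^ 2 ≠ u j ^ 2) ∧
    ∀ i, SignGeneric (u ∘ Equiv.swap 0 i)

theorem exists_generic :
    ∃ R : MvPolynomial (Fin 6) ℂ, R ≠ 0 ∧ ∀ u, eval u R ≠ 0 → Generic u := by
  obtain ⟨R₁, hR₁, h₁⟩ := exists_common_nonvanishing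
    (fun (j : Fin 6) (u : Fin 6 → ℂ) => u j ≠ 0) fun j =>
    ⟨X j, X_ne_zero j, fun u hu => by simpa using hu⟩
  obtain ⟨R₂, hR₂, h₂⟩ := exists_common_nonvanishing
    (fun (ij : Fin 6 × Fin 6) (u : Fin 6 → ℂ) => ij.1 ≠ ij.2 → u ij.1 ^ 2 ≠ u ij.2 ^ 2) fun ij => by
    by_cases h : ij.1 = ij.2
    · exact ⟨1, one_ne_zero, fun u _ h' => absurd h h'⟩
    · refine ⟨X ij.1 ^ 2 - X ij.2 ^ 2, fun h0 => ?_, fun u hu _ => ?_⟩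
      · have := congrArg (eval (Pi.single ij.1 1)) h0
        simp [Ne.symm h] at this
      · simpa [sub_eq_zero] using hu
  obtain ⟨R, hR, h⟩ := exists_signGeneric
  obtain ⟨R₃, hR₃, h₃⟩ := exists_common_nonvanishing
    (fun (i : Fin 6) (u : Fin 6 → ℂ) => SignGeneric (u ∘ Equiv.swap 0 i)) fun i =>
    ⟨rename (Equiv.swap 0 i) R, by
      rwa [Ne, map_eq_zero_iff _ (rename_injective _ (Equiv.injective _))], fun u hu => by
      rw [eval_rename] at hu
      exact h _ hu⟩
  refine ⟨R₁ * R₂ * R₃, mul_ne_zero (mul_ne_zero hR₁ hR₂) hR₃, fun u hu => ?_⟩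
  rw [map_mul, map_mul] at hu
  exact ⟨h₁ u (left_ne_zero_of_mul (left_ne_zero_of_mul hu)),
    fun i j => h₂ u (right_ne_zero_of_mul (left_ne_zero_of_mul hu)) (i, j),
    h₃ u (right_ne_zero_of_mul hu)⟩

theorem form2_subst (c : Fin 3 → ℂ) (a b a' b' : ℂ) :
    ∃ c' : Fin 3 → ℂ, ∀ X Y, form2 c (a * X + b * Y) (a' * X + b' * Y) = form2 c' X Y :=
  ⟨![c 0 * a ^ 2 + c 1 * a * a' + c 2 * a' ^ 2,
    2 * c 0 * a * b + c 1 * (a * b' + b * a') + 2 * c 2 * a' * b',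
    c 0 * b ^ 2 + c 1 * b * b' + c 2 * b' ^ 2], fun X Y => by simp [form2]; ring⟩

theorem form3_subst (d : Fin 4 → ℂ) (a b a' b' : ℂ) :
    ∃ d' : Fin 4 → ℂ, ∀ X Y, form3 d (a * X + b * Y) (a' * X + b' * Y) = form3 d' X Y :=
  ⟨![d 0 * a ^ 3 + d 1 * a ^ 2 * a' + d 2 * a * a' ^ 2 + d 3 * a' ^ 3,
    3 * d 0 * a ^ 2 * b + d 1 * (2 * a * b * a' + a ^ 2 * b') + d 2 * (b * a' ^ 2 + 2 * a * a' * b')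
      + 3 * d 3 * a' ^ 2 * b',
    3 * d 0 * a * b ^ 2 + d 1 * (b ^ 2 * a' + 2 * a * b * b') + d 2 * (2 * b * a' * b' + a * b' ^ 2)
      + 3 * d 3 * a' * b' ^ 2,
    d 0 * b ^ 3 + d 1 * b ^ 2 * b' + d 2 * b * b' ^ 2 + d 3 * b' ^ 3], fun X Y => by
      simp [form3]; ring⟩

theorem form4_subst (e : Fin 5 → ℂ) (a b a' b' : ℂ) :
    ∃ e' : Fin 5 → ℂ, ∀ X Y, form4 e (a * X + b * Y) (a' * X + b' * Y) = form4 e' X Y :=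
  ⟨![e 0 * a ^ 4 + e 1 * a ^ 3 * a' + e 2 * a ^ 2 * a' ^ 2 + e 3 * a * a' ^ 3 + e 4 * a' ^ 4,
    4 * e 0 * a ^ 3 * b + e 1 * (3 * a ^ 2 * b * a' + a ^ 3 * b')
      + e 2 * (2 * a * b * a' ^ 2 + 2 * a ^ 2 * a' * b')
      + e 3 * (b * a' ^ 3 + 3 * a * a' ^ 2 * b') + 4 * e 4 * a' ^ 3 * b',
    6 * e 0 * a ^ 2 * b ^ 2 + e 1 * (3 * a * b ^ 2 * a' + 3 * a ^ 2 * b * b')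
      + e 2 * (b ^ 2 * a' ^ 2 + 4 * a * b * a' * b' + a ^ 2 * b' ^ 2)
      + e 3 * (3 * b * a' ^ 2 * b' + 3 * a * a' * b' ^ 2) + 6 * e 4 * a' ^ 2 * b' ^ 2,
    4 * e 0 * a * b ^ 3 + e 1 * (b ^ 3 * a' + 3 * a * b ^ 2 * b')
      + e 2 * (2 * b ^ 2 * a' * b' + 2 * a * b * b' ^ 2)
      + e 3 * (3 * b * a' * b' ^ 2 + a * b' ^ 3) + 4 * e 4 * a' * b' ^ 3,
    e 0 * b ^ 4 + e 1 * b ^ 3 * b' + e 2 * b ^ 2 * b' ^ 2 + e 3 * b * b' ^ 3 + e 4 * b' ^ 4],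
    fun X Y => by simp [form4]; ring⟩

theorem form2_factor (c : Fin 3 → ℂ) (hc : c 1 ^ 2 - 4 * c 0 * c 2 ≠ 0) :
    ∃ α₁ β₁ α₂ β₂ : ℂ, α₁ * β₂ - α₂ * β₁ ≠ 0 ∧
      ∀ x y, form2 c x y = (α₁ * x + β₁ * y) * (α₂ * x + β₂ * y) := by
  by_cases h0 : c 0 = 0
  · refine ⟨0, 1, c 1, c 2, fun h => hc ?_, fun x y => ?_⟩
    · rw [h0]; linear_combination (-c 1) * h
    · rw [form2, h0]; ring
  · obtain ⟨w, hw⟩ := exists_sq_root (c 1 ^ 2 - 4 * c 0 * c 2)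
    refine ⟨c 0, (c 1 - w) / 2, 1, (c 1 + w) / (2 * c 0), fun h => hc ?_, fun x y => ?_⟩
    · have : w = 0 := by
        field_simp at h
        linear_combination (1/2) * h
      rw [← hw, this]; ring
    · rw [form2]
      field_simp
      linear_combination y ^ 2 * hw

/-- The coordinates of a quartic with a node, adapted to the tangent cone. -/
theorem exists_adapted_coordinates {c : Fin 3 → ℂ} {d : Fin 4 → ℂ} {e : Fin 5 → ℂ} {r : Fin 6 → ℂ}
    (hc : c 1 ^ 2 - 4 * c 0 * c 2 ≠ 0)
    (hD : ∀ x y, tangentForm c d e x y = 4 * ∏ j, (x - r j * y)) :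
    ∃ (p q : Fin 6 → ℂ) (α₁ β₁ α₂ β₂ a b : ℂ), α₁ * β₂ - α₂ * β₁ ≠ 0 ∧
      (∀ j, α₁ * r j + β₁ = (α₁ * β₂ - α₂ * β₁) * p j ^ 2) ∧
      (∀ j, α₂ * r j + β₂ = (α₁ * β₂ - α₂ * β₁) * q j ^ 2) ∧
      ∀ x y z, doubleQuartic c d e x y z = nodalQuartic p q (α₁ * x + β₁ * y) (α₂ * x + β₂ * y)
        (z - (a * (α₁ * x + β₁ * y) + b * (α₂ * x + β₂ * y))) := by
  obtain ⟨α₁, β₁, α₂, β₂, hΔ, hf⟩ := form2_factor c hc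
  set Δ := α₁ * β₂ - α₂ * β₁ with hΔdef
  obtain ⟨d', hd'⟩ := form3_subst d (β₂ / Δ) (-β₁ / Δ) (-α₂ / Δ) (α₁ / Δ)
  obtain ⟨e', he'⟩ := form4_subst e (β₂ / Δ) (-β₁ / Δ) (-α₂ / Δ) (α₁ / Δ)
  have hx : ∀ x y : ℂ, β₂ / Δ * (α₁ * x + β₁ * y) + -β₁ / Δ * (α₂ * x + β₂ * y) = x := by
    intro x y
    field_simp
    rw [hΔdef]; ring
  have hy : ∀ x y : ℂ, -α₂ / Δ * (α₁ * x + β₁ * y) + α₁ / Δ * (α₂ * x + β₂ * y) = y := by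
    intro x y
    field_simp
    rw [hΔdef]; ring
  have hX : ∀ X Y : ℂ, α₁ * (β₂ / Δ * X + -β₁ / Δ * Y) + β₁ * (-α₂ / Δ * X + α₁ / Δ * Y) = X := by
    intro X Y
    field_simp
    rw [hΔdef]; ring
  have hY : ∀ X Y : ℂ, α₂ * (β₂ / Δ * X + -β₁ / Δ * Y) + β₂ * (-α₂ / Δ * X + α₁ / Δ * Y) = Y := by
    intro X Y
    field_simp
    rw [hΔdef]; ring
  obtain ⟨p, q, a, b, hp, hq, h⟩ := exists_nodal_normal_form d' e'
    (fun j => (α₁ * r j + β₁) / Δ) (fun j => (α₂ * r j + β₂) / Δ) (fun X Y => by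
      have h1 := hD (β₂ / Δ * X + -β₁ / Δ * Y) (-α₂ / Δ * X + α₁ / Δ * Y)
      rw [tangentForm, hf, hX, hY, hd', he'] at h1
      rw [h1]
      congr 1
      refine Finset.prod_congr rfl fun j _ => ?_
      ring)
  refine ⟨p, q, α₁, β₁, α₂, β₂, a, b, hΔ, fun j => ?_, fun j => ?_, fun x y z => ?_⟩
  · rw [hp, ← hΔdef]; field_simp
  · rw [hq, ← hΔdef]; field_simp
  · rw [← h, ← hd', ← he', hx, hy, doubleQuartic, hf]

/-- Twelve even sign choices, in two groups of three pairs. -/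
def evenSigns : Fin 2 → Fin 3 → Fin 2 → Fin 5 → Bool :=
  ![![![![false, false, false, false, false], ![false, true, true, true, true]],
      ![![false, false, false, true, true], ![false, true, true, false, false]],
      ![![false, false, true, false, true], ![false, true, false, true, false]]],
    ![![![true, true, false, false, false], ![true, false, true, true, true]],
      ![![true, false, true, false, false], ![true, true, false, true, true]],
      ![![true, false, false, true, false], ![true, true, true, false, true]]]]

theorem evenSigns_injective : ∀ o k i o' k' i', evenSigns o k i = evenSigns o' k' i' →
    o = o' ∧ k = k' ∧ i = i' := by
  decide

theorem evenSigns_prod (o : Fin 2) (k : Fin 3) (i : Fin 2) :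
    ∏ j, (boolSign (evenSigns o k i j) : ℂ) = 1 := by
  fin_cases o <;> fin_cases k <;> fin_cases i <;>
    simp [evenSigns, boolSign, Fin.prod_univ_five]

theorem evenSigns_pair (p q : Fin 6 → ℂ) (o : Fin 2) : ∃ K : ℂ, ∀ k : Fin 3,
    (∏ j : Fin 5, (q j.succ * p 0 + boolSign (evenSigns o k 0 j) * p j.succ * q 0)) *
      (∏ j : Fin 5, (q j.succ * p 0 + boolSign (evenSigns o k 1 j) * p j.succ * q 0)) = K := by
  refine ⟨(∏ j : Fin 5, (q j.succ * p 0 + boolSign (evenSigns o 0 0 j) * p j.succ * q 0)) *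
      (∏ j : Fin 5, (q j.succ * p 0 + boolSign (evenSigns o 0 1 j) * p j.succ * q 0)), fun k => ?_⟩
  simp only [← Finset.prod_mul_distrib]
  refine Finset.prod_congr rfl fun j _ => ?_
  fin_cases o <;> fin_cases k <;> fin_cases j <;> simp [evenSigns, boolSign] <;> ring

theorem flipSigns_sexticCoeff_six {p q : Fin 6 → ℂ} {s : Fin 5 → Bool}
    (hs : ∏ j, (boolSign (s j) : ℂ) = 1) :
    sexticCoeff (flipSigns s p) q 6 = sexticCoeff p q 6 := by
  rw [sexticCoeff_six, sexticCoeff_six, Fin.prod_univ_succ (flipSigns s p), Fin.prod_univ_succ p]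
  simp [Finset.prod_mul_distrib, hs]

/-- Common tangent lines force the two quartics to touch each tangent line through the node at
the same point. -/
theorem contact_eq {u : Fin 6 → ℂ} (hu0 : u 0 ≠ 0) (hu : ∀ i j, i ≠ j → u i ^ 2 ≠ u j ^ 2)
    (hg : SignGeneric u) {c : Fin 3 → ℂ} {d : Fin 4 → ℂ} {e : Fin 5 → ℂ}
    (hc : c 1 ^ 2 - 4 * c 0 * c 2 ≠ 0)
    (hD : ∀ x y, tangentForm c d e x y = 4 * ∏ j, (x - u j ^ 2 * y))
    (hL : ∀ a b, SqLine (doubleQuartic c d e) a b → SqLine (nodalQuartic u 1) a b) :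
    form3 d (u 0 ^ 2) 1 * u 0 ^ 2 = form2 c (u 0 ^ 2) 1 * (2 * evenPart u 1 (u 0 ^ 2) 1) := by
  obtain ⟨p, q, α₁, β₁, α₂, β₂, a, b, hΔ, hp, hq, hG⟩ := exists_adapted_coordinates hc hD
  set Δ := α₁ * β₂ - α₂ * β₁ with hΔdef
  have hG0 : ∀ z, doubleQuartic c d e (u 0 ^ 2) 1 z
      = nodalQuartic p q (Δ * p 0 ^ 2) (Δ * q 0 ^ 2)
        (z - (a * (Δ * p 0 ^ 2) + b * (Δ * q 0 ^ 2))) := by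
    intro z
    rw [hG, ← hp, ← hq]; ring_nf
  have hc0 : form2 c (u 0 ^ 2) 1 = Δ ^ 2 * (p 0 * q 0) ^ 2 := by
    have h1 := hG0 1
    have h2 := hG0 (-1)
    have h3 := hG0 0
    simp only [doubleQuartic, nodalQuartic] at h1 h2 h3
    linear_combination (1/2) * h1 + (1/2) * h2 - h3
  have hd0 : form3 d (u 0 ^ 2) 1 = 2 * Δ ^ 3 * (evenPart p q (p 0 ^ 2) (q 0 ^ 2)
      - (p 0 * q 0) ^ 2 * (a * p 0 ^ 2 + b * q 0 ^ 2)) := by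
    have h1 := hG0 1
    have h2 := hG0 (-1)
    simp only [doubleQuartic, nodalQuartic, evenPart] at h1 h2 ⊢
    linear_combination (1/2) * h1 - (1/2) * h2
  by_cases h0 : p 0 * q 0 = 0
  · have h1 := hD (u 0 ^ 2) 1
    rw [Finset.prod_eq_zero (Finset.mem_univ 0) (by ring), tangentForm, hc0, h0] at h1
    have h2 : form3 d (u 0 ^ 2) 1 ^ 2 = 0 := by linear_combination h1
    rw [pow_eq_zero_iff (by norm_num)] at h2
    rw [h2, hc0, h0]; ring
  have hp0 := left_ne_zero_of_mul h0
  have hq0 := right_ne_zero_of_mul h0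
  have hne : ∀ i j, i ≠ j → p i ^ 2 * q j ^ 2 ≠ p j ^ 2 * q i ^ 2 := by
    intro i j hij h
    apply mul_ne_zero hΔ (sub_ne_zero.2 (hu i j hij))
    rw [hΔdef]
    linear_combination Δ ^ 2 * h + (α₂ * u j ^ 2 + β₂) * hp i - (α₂ * u i ^ 2 + β₂) * hp j
      + Δ * p i ^ 2 * hq j - Δ * p j ^ 2 * hq i
  have hline : ∀ s : Fin 5 → Bool, ∏ j, (boolSign (s j) : ℂ) = 1 → ∃ t : Fin 5 → Bool,
      (a + (sexticCoeff (flipSigns s p) q 2 - sexticCoeff p q 2)) * α₁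
        + (b + (sexticCoeff (flipSigns s p) q 4 - sexticCoeff p q 4)) * α₂
        = sexticCoeff (flipSigns t u) 1 2 - sexticCoeff u 1 2 ∧
      (a + (sexticCoeff (flipSigns s p) q 2 - sexticCoeff p q 2)) * β₁
        + (b + (sexticCoeff (flipSigns s p) q 4 - sexticCoeff p q 4)) * β₂
        = sexticCoeff (flipSigns t u) 1 4 - sexticCoeff u 1 4 ∧
      sexticCoeff (flipSigns t u) 1 6 = sexticCoeff u 1 6 := by
    intro s hs
    refine exists_signs_of_sqLine (fun i j hij => by_contra fun h => hu i j h hij) (hL _ _ ?_)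
    obtain ⟨c', hc'⟩ := form2_subst
      ![sexticCoeff (flipSigns s p) q 1, sexticCoeff (flipSigns s p) q 3,
        sexticCoeff (flipSigns s p) q 5] α₁ β₁ α₂ β₂
    refine ⟨c' 0, c' 1, c' 2, fun x y => ?_⟩
    have h1 := nodalQuartic_line (flipSigns_sq s p) (flipSigns_sexticCoeff_six (q := q) hs)
      (α₁ * x + β₁ * y) (α₂ * x + β₂ * y)
    have h2 := hc' x y
    rw [hG]
    simp only [form2] at h2
    rw [← h2]
    refine Eq.trans ?_ (h1.trans ?_)
    · congr 1; ring
    · simp [oddPart]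
  choose! t ht₁ ht₂ ht₃ using hline
  have hinj : ∀ s s', ∏ j, (boolSign (s j) : ℂ) = 1 → ∏ j, (boolSign (s' j) : ℂ) = 1 →
      t s = t s' → s = s' := by
    intro s s' hs hs' hss
    have e1 := (ht₁ s hs).trans ((by rw [hss] : _ = _).trans (ht₁ s' hs').symm)
    have e2 := (ht₂ s hs).trans ((by rw [hss] : _ = _).trans (ht₂ s' hs').symm)
    have k2 : sexticCoeff (flipSigns s p) q 2 = sexticCoeff (flipSigns s' p) q 2 := by
      apply mul_left_cancel₀ hΔ
      rw [hΔdef]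
      linear_combination β₂ * e1 - α₂ * e2
    have k4 : sexticCoeff (flipSigns s p) q 4 = sexticCoeff (flipSigns s' p) q 4 := by
      apply mul_left_cancel₀ hΔ
      rw [hΔdef]
      linear_combination α₁ * e2 - β₁ * e1
    refine signs_eq_of_evenPart h0 hne hs hs' fun X Y => ?_
    rw [evenPart_sub_of_sq (flipSigns_sexticCoeff_six hs),
      evenPart_sub_of_sq (flipSigns_sexticCoeff_six hs'), k2, k4]
  set w := u 0 * Δ / (p 0 * q 0) with hw
  set z := evenPart u 1 (u 0 ^ 2) 1 / u 0 + u 0 * Δ * (a * p 0 ^ 2 + b * q 0 ^ 2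
    - evenPart p q (p 0 ^ 2) (q 0 ^ 2) / (p 0 * q 0) ^ 2) with hz
  have hT : ∀ s, ∏ j, (boolSign (s j) : ℂ) = 1 → signProd (t s) u - z
      = w * ∏ j : Fin 5, (q j.succ * p 0 + boolSign (s j) * p j.succ * q 0) := by
    intro s hs
    have h1 := line_height (ht₁ s hs) (ht₂ s hs) (ht₃ s hs)
    have h2 := evenPart_root (flipSigns s p) q
    rw [evenPart_sub_of_sq (flipSigns_sexticCoeff_six hs)] at h2
    simp only [flipSigns_zero, flipSigns_succ] at h2
    have h3 := hp 0
    have h4 := hq 0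
    generalize (∏ j : Fin 5, (q j.succ * p 0 + boolSign (s j) * p j.succ * q 0)) = T at *
    generalize sexticCoeff (flipSigns s p) q 2 - sexticCoeff p q 2 = κ at *
    generalize sexticCoeff (flipSigns s p) q 4 - sexticCoeff p q 4 = μ at *
    generalize evenPart p q (p 0 ^ 2) (q 0 ^ 2) = E at *
    have h5 : u 0 * signProd (t s) u = evenPart u 1 (u 0 ^ 2) 1
        + u 0 ^ 2 * Δ * ((a + κ) * p 0 ^ 2 + (b + μ) * q 0 ^ 2) := by
      linear_combination -h1 + u 0 ^ 2 * (a + κ) * h3 + u 0 ^ 2 * (b + μ) * h4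
    have h6 : signProd (t s) u = (evenPart u 1 (u 0 ^ 2) 1
        + u 0 ^ 2 * Δ * ((a + κ) * p 0 ^ 2 + (b + μ) * q 0 ^ 2)) / u 0 := by
      field_simp; linear_combination h5
    rw [h6, hz, hw]
    field_simp
    linear_combination u 0 ^ 2 * Δ * h2
  choose K hK using evenSigns_pair p q
  have hz0 := hg (fun o k i => t (evenSigns o k i)) (fun o k i o' k' i' h =>
    evenSigns_injective _ _ _ _ _ _ (hinj _ _ (evenSigns_prod _ _ _) (evenSigns_prod _ _ _) h))
    z (fun o => w ^ 2 * K o) (fun o k => by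
      rw [hT _ (evenSigns_prod _ _ _), hT _ (evenSigns_prod _ _ _), ← hK o k]; ring)
  rw [hd0, hc0]
  rw [hz] at hz0
  field_simp at hz0
  linear_combination (-2) * Δ ^ 2 * hz0

theorem nodalQuartic_comp_perm (u : Fin 6 → ℂ) (σ : Equiv.Perm (Fin 6)) :
    nodalQuartic (u ∘ σ) 1 = nodalQuartic u 1 ∧ evenPart (u ∘ σ) 1 = evenPart u 1 := by
  have h := sexticCoeff_comp_perm u 1 σ
  have h1 : (1 : Fin 6 → ℂ) ∘ σ = 1 := rfl
  rw [h1] at h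
  have hE : evenPart (u ∘ σ) 1 = evenPart u 1 := by
    funext X Y
    simp only [evenPart, h 0 (by norm_num), h 2 (by norm_num), h 4 (by norm_num),
      h 6 (by norm_num)]
  refine ⟨?_, hE⟩
  funext X Y z
  simp only [nodalQuartic, hE, oddPart, h 1 (by norm_num), h 3 (by norm_num), h 5 (by norm_num)]

theorem quartic_unique_of_scaled {u : Fin 6 → ℂ} (hu : Generic u) {c : Fin 3 → ℂ} {d : Fin 4 → ℂ}
    {e : Fin 5 → ℂ} (hc : c 1 ^ 2 - 4 * c 0 * c 2 ≠ 0)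
    (hD : ∀ x y, tangentForm c d e x y = 4 * ∏ j, (x - u j ^ 2 * y))
    (hL : ∀ a b, SqLine (doubleQuartic c d e) a b → SqLine (nodalQuartic u 1) a b) :
    ∃ ρ : ℂ, ρ ≠ 0 ∧ ∀ x y z, doubleQuartic c d e x y z = ρ * nodalQuartic u 1 x y z := by
  obtain ⟨hu0, hu1, hu2⟩ := hu
  have hcontact : ∀ i, form3 d (u i ^ 2) 1 * u i ^ 2
      = form2 c (u i ^ 2) 1 * (2 * evenPart u 1 (u i ^ 2) 1) := by
    intro i
    obtain ⟨h1, h2⟩ := nodalQuartic_comp_perm u (Equiv.swap 0 i)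
    have := contact_eq (u := u ∘ Equiv.swap 0 i) (hu0 _)
      (fun j k hjk => hu1 _ _ fun h => hjk ((Equiv.swap 0 i).injective h)) (hu2 i) hc
      (fun x y => by
        rw [hD]
        congr 1
        exact (Equiv.prod_comp (Equiv.swap 0 i) (fun j => x - u j ^ 2 * y)).symm)
      (by rw [h1]; exact hL)
    rw [h2] at this
    simpa using this
  have hk0 : sexticCoeff u 1 0 = 1 := by simp [sexticCoeff_zero]
  have hk6 : sexticCoeff u 1 6 ≠ 0 := by
    rw [sexticCoeff_six]; exact Finset.prod_ne_zero_iff.2 fun j _ => hu0 j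
  have key := coeff_eq_zero_of_roots (n := 6) (fun i => match i with
    | 0 => - 2 * c 2 * sexticCoeff u 1 6
    | 1 => d 3 - 2 * (c 1 * sexticCoeff u 1 6 + c 2 * sexticCoeff u 1 4)
    | 2 => d 2 - 2 * (c 0 * sexticCoeff u 1 6 + c 1 * sexticCoeff u 1 4 + c 2 * sexticCoeff u 1 2)
    | 3 => d 1 - 2 * (c 0 * sexticCoeff u 1 4 + c 1 * sexticCoeff u 1 2 + c 2)
    | 4 => d 0 - 2 * (c 0 * sexticCoeff u 1 2 + c 1)
    | _ => - 2 * c 0) (fun j => u j ^ 2)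
    (fun i j hij => by_contra fun h => hu1 i j h hij) (fun j => by
      have := hcontact j
      simp only [form3, form2, evenPart, hk0] at this
      simp only [Finset.sum_range_succ, Finset.sum_range_zero]
      linear_combination this)
  have k0 := key 0 (by norm_num)
  have k1 := key 1 (by norm_num)
  have k2 := key 2 (by norm_num)
  have k3 := key 3 (by norm_num)
  have k4 := key 4 (by norm_num)
  have k5 := key 5 (by norm_num)
  simp only at k0 k1 k2 k3 k4 k5
  have hc2 : c 2 = 0 := by
    apply mul_right_cancel₀ hk6
    linear_combination (-1/2) * k0
  have hc0 : c 0 = 0 := by linear_combination (-1/2) * k5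
  simp only [hc0, hc2, zero_mul, zero_add, add_zero] at k1 k2 k3 k4
  have hc1 : c 1 ≠ 0 := by
    rintro h
    apply hc
    rw [h, hc0]; ring
  have h3 : ∀ x y, form3 d x y = c 1 * (2 * evenPart u 1 x y) := by
    intro x y
    rw [form3, evenPart, hk0]
    linear_combination x ^ 3 * k4 + x ^ 2 * y * k3 + x * y ^ 2 * k2 + y ^ 3 * k1
  have h2 : ∀ x y, form2 c x y = c 1 * (x * y) := by
    intro x y
    rw [form2, hc0, hc2]; ring
  have hD' : ∀ x y, c 1 ^ 2 * evenPart u 1 x y ^ 2 - c 1 * (x * y) * form4 e x y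
      = evenPart u 1 x y ^ 2 - x * y * oddPart u 1 x y ^ 2 := by
    intro x y
    have h5 := hD x y
    have h6 := evenPart_sq_sub u 1 x y
    simp only [Pi.one_apply, one_pow, one_mul] at h6
    rw [← h6, tangentForm, h3, h2] at h5
    linear_combination (1/4) * h5
  have hsq : c 1 ^ 2 = 1 := by
    have := hD' 1 0
    simp only [evenPart, hk0] at this
    linear_combination this
  have h4 : ∀ x y, form4 e x y = c 1 * oddPart u 1 x y ^ 2 := by
    refine eq_of_eq_off_axes ?_ ?_ fun x y hxy => ?_
    · simp only [form4]; fun_prop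
    · simp only [oddPart]; fun_prop
    · apply mul_left_cancel₀ (mul_ne_zero hc1 hxy)
      linear_combination (-1) * hD' x y + (evenPart u 1 x y ^ 2 - x * y * oddPart u 1 x y ^ 2) * hsq
  refine ⟨c 1, hc1, fun x y z => ?_⟩
  rw [doubleQuartic, nodalQuartic, h2, h3, h4]
  ring

theorem SqLine.of_mul {f g : ℂ → ℂ → ℂ → ℂ} {r a b : ℂ} (hfg : ∀ x y z, g x y z = r * f x y z)
    (h : SqLine f a b) : SqLine g a b := by
  obtain ⟨m₀, m₁, m₂, h⟩ := h
  obtain ⟨w, rfl⟩ := exists_sq_root r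
  exact ⟨w * m₀, w * m₁, w * m₂, fun s t => by rw [hfg, h]; ring⟩

/-- A quartic with a node at `(0, 0, 1)` sharing its tangents through the node and its other
tangent lines with a general nodal quartic is proportional to it. -/
theorem quartic_unique {u : Fin 6 → ℂ} (hu : Generic u) {c : Fin 3 → ℂ} {d : Fin 4 → ℂ}
    {e : Fin 5 → ℂ} (hc : c 1 ^ 2 - 4 * c 0 * c 2 ≠ 0)
    (hD : ∀ x y, ¬ (x = 0 ∧ y = 0) →
      (tangentForm c d e x y = 0 ↔ ∏ j, (x - u j ^ 2 * y) = 0))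
    (hL : ∀ a b, SqLine (doubleQuartic c d e) a b → SqLine (nodalQuartic u 1) a b) :
    ∃ ρ : ℂ, ρ ≠ 0 ∧ ∀ x y z, doubleQuartic c d e x y z = ρ * nodalQuartic u 1 x y z := by
  set t : ℕ → ℂ := fun i => match i with
    | 0 => d 0 ^ 2 - 4 * c 0 * e 0
    | 1 => 2 * d 0 * d 1 - 4 * (c 0 * e 1 + c 1 * e 0)
    | 2 => d 1 ^ 2 + 2 * d 0 * d 2 - 4 * (c 0 * e 2 + c 1 * e 1 + c 2 * e 0)
    | 3 => 2 * d 0 * d 3 + 2 * d 1 * d 2 - 4 * (c 0 * e 3 + c 1 * e 2 + c 2 * e 1)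
    | 4 => d 2 ^ 2 + 2 * d 1 * d 3 - 4 * (c 0 * e 4 + c 1 * e 3 + c 2 * e 2)
    | 5 => 2 * d 2 * d 3 - 4 * (c 1 * e 4 + c 2 * e 3)
    | _ => d 3 ^ 2 - 4 * c 2 * e 4 with ht
  have hexp : ∀ x y, tangentForm c d e x y = t 0 * x ^ 6 + t 1 * x ^ 5 * y + t 2 * x ^ 4 * y ^ 2
      + t 3 * x ^ 3 * y ^ 3 + t 4 * x ^ 2 * y ^ 4 + t 5 * x * y ^ 5 + t 6 * y ^ 6 := by
    intro x y
    simp only [ht, tangentForm, form2, form3, form4]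
    ring
  have hroots := sextic_of_roots t (fun j => u j ^ 2)
    (fun i j hij => by_contra fun h => hu.2.1 i j h hij) (fun j => by
      have h1 := (hD (u j ^ 2) 1 (by simp)).2
        (Finset.prod_eq_zero (Finset.mem_univ j) (by ring))
      rw [hexp] at h1
      linear_combination h1)
  have hprod : ∀ x y, tangentForm c d e x y = t 0 * ∏ j, (x - u j ^ 2 * y) := by
    intro x y
    have h1 := sexticCoeff_prod (fun j => u j ^ 2) 1 x y
    simp only [Pi.one_apply, one_mul] at h1
    have h0 : sexticCoeff (fun j => u j ^ 2) 1 0 = 1 := by simp [sexticCoeff_zero]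
    rw [hexp, ← h1, hroots 1 (by norm_num), hroots 2 (by norm_num), hroots 3 (by norm_num),
      hroots 4 (by norm_num), hroots 5 (by norm_num), hroots 6 (by norm_num), h0]
    ring
  have ht0 : t 0 ≠ 0 := by
    intro h
    have := (hD 1 0 (by simp)).1 (by rw [hprod, h, zero_mul])
    simp at this
  obtain ⟨r, hr⟩ := exists_sq_root (4 / t 0)
  have hr0 : r ≠ 0 := by
    rintro rfl
    field_simp at hr
    norm_num at hr
  have hscale : ∀ x y z, doubleQuartic (r • c) (r • d) (r • e) x y z
      = r * doubleQuartic c d e x y z := by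
    intro x y z
    simp only [doubleQuartic, form2, form3, form4, Pi.smul_apply, smul_eq_mul]
    ring
  obtain ⟨ρ, hρ, h⟩ := quartic_unique_of_scaled hu (c := r • c) (d := r • d) (e := r • e)
    (by
      intro h
      apply hc
      simp only [Pi.smul_apply, smul_eq_mul] at h
      apply mul_left_cancel₀ (pow_ne_zero 2 hr0)
      linear_combination h)
    (fun x y => by
      have h1 : tangentForm (r • c) (r • d) (r • e) x y = r ^ 2 * tangentForm c d e x y := by
        simp only [tangentForm, form2, form3, form4, Pi.smul_apply, smul_eq_mul]
        ring
      rw [h1, hprod, hr, ← mul_assoc, div_mul_cancel₀ _ ht0])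
    (fun a b hab => hL a b (hab.of_mul (r := r⁻¹) fun x y z => by
      rw [hscale]; field_simp))
  refine ⟨ρ / r, div_ne_zero hρ hr0, fun x y z => ?_⟩
  have := h x y z
  rw [hscale] at this
  field_simp
  linear_combination this

/-- A plane quartic form, expanded in powers of the third variable. -/
def IsQuarticForm (f : ℂ → ℂ → ℂ → ℂ) : Prop :=
  ∃ (k : ℂ) (l : Fin 2 → ℂ) (c : Fin 3 → ℂ) (d : Fin 4 → ℂ) (e : Fin 5 → ℂ), ∀ x y z,
    f x y z = k * z ^ 4 + (l 0 * x + l 1 * y) * z ^ 3 + doubleQuartic c d e x y z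

theorem IsQuarticForm.add {f g : ℂ → ℂ → ℂ → ℂ} (hf : IsQuarticForm f) (hg : IsQuarticForm g) :
    IsQuarticForm (fun x y z => f x y z + g x y z) := by
  obtain ⟨k, l, c, d, e, hf⟩ := hf
  obtain ⟨k', l', c', d', e', hg⟩ := hg
  refine ⟨k + k', l + l', c + c', d + d', e + e', fun x y z => ?_⟩
  simp only [hf, hg]
  simp only [doubleQuartic, form2, form3, form4, Pi.add_apply]
  ring

theorem isQuarticForm_monomial (a : ℂ) (i j k : ℕ) (h : i + j + k = 4) :
    IsQuarticForm (fun x y z => a * (x ^ i * y ^ j * z ^ k)) := by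
  have hk : k ≤ 4 := by omega
  have hj : j ≤ 4 := by omega
  obtain rfl : i = 4 - j - k := by omega
  refine ⟨if k = 4 then a else 0, fun n => if k = 3 ∧ j = n then a else 0,
    fun n => if k = 2 ∧ j = n then a else 0, fun n => if k = 1 ∧ j = n then a else 0,
    fun n => if k = 0 ∧ j = n then a else 0, fun x y z => ?_⟩
  simp only [doubleQuartic, form2, form3, form4]
  interval_cases k <;> interval_cases j <;> first | omega | (simp; try ring)

theorem isQuarticForm_eval {H : MvPolynomial (Fin 3) ℂ} (hH : H.IsHomogeneous 4) :
    IsQuarticForm (fun x y z => eval ![x, y, z] H) := by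
  have key : ∀ S : Finset (Fin 3 →₀ ℕ), (∀ m ∈ S, m 0 + m 1 + m 2 = 4) →
      IsQuarticForm (fun x y z => ∑ m ∈ S, coeff m H * ∏ i, (![x, y, z] : Fin 3 → ℂ) i ^ m i) := by
    intro S
    induction S using Finset.induction_on with
    | empty => exact fun _ => ⟨0, 0, 0, 0, 0, fun x y z => by
        simp [doubleQuartic, form2, form3, form4]⟩
    | insert m S hm ih =>
      intro hS
      simp only [Finset.sum_insert hm]
      refine IsQuarticForm.add ?_ (ih fun n hn => hS n (Finset.mem_insert_of_mem hn))
      simpa [Fin.prod_univ_three] using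
        isQuarticForm_monomial (coeff m H) (m 0) (m 1) (m 2) (hS m (Finset.mem_insert_self _ _))
  simp only [eval_eq']
  refine key _ fun m hm => ?_
  have := hH (mem_support_iff.1 hm)
  rw [Finsupp.weight_apply, Finsupp.sum_fintype _ _ (by simp)] at this
  simpa [Fin.sum_univ_three] using this

theorem isQuarticForm_eval_comb {H : MvPolynomial (Fin 3) ℂ} (hH : H.IsHomogeneous 4)
    (u v w : Fin 3 → ℂ) :
    IsQuarticForm (fun x y z => eval (x • u + y • v + z • w) H) := by
  have h1 : (aeval (fun i => C (u i) * X 0 + C (v i) * X 1 + C (w i) * X 2 :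
      Fin 3 → MvPolynomial (Fin 3) ℂ) H).IsHomogeneous 4 := by
    simpa using hH.aeval _ fun i => ((isHomogeneous_C_mul_X (u i) 0).add
      (isHomogeneous_C_mul_X (v i) 1)).add (isHomogeneous_C_mul_X (w i) 2)
  convert isQuarticForm_eval h1 using 4 with x y z
  rw [map_aeval, ← eval₂_id, coe_eval₂Hom]
  congr 1
  · ext; simp
  · ext i; simp; ring

theorem exists_form4_eval {H : MvPolynomial (Fin 3) ℂ} (hH : H.IsHomogeneous 4)
    (v w : Fin 3 → ℂ) : ∃ e : Fin 5 → ℂ, ∀ s t, eval (s • v + t • w) H = form4 e s t := by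
  obtain ⟨k, l, c, d, e, h⟩ := isQuarticForm_eval_comb hH v w 0
  exact ⟨e, fun s t => by simpa [doubleQuartic] using h s t 0⟩

theorem eval_lineRest (H : MvPolynomial (Fin 3) ℂ) (a b : Fin 3 → ℂ) (t : ℂ) :
    (lineRest H a b).eval t = eval (a + t • b) H := by
  rw [lineRest, ← Polynomial.coe_evalRingHom, hom_eval₂, ← eval₂_id]
  congr 1
  · ext; simp
  · ext i; simp; ring

/-- The first order variation of a binary quartic. -/
def polar4 (e : Fin 5 → ℂ) (α β γ δ : ℂ) : ℂ :=
  γ * (4 * e 0 * α ^ 3 + 3 * e 1 * α ^ 2 * β + 2 * e 2 * α * β ^ 2 + e 3 * β ^ 3)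
    + δ * (e 1 * α ^ 3 + 2 * e 2 * α ^ 2 * β + 3 * e 3 * α * β ^ 2 + 4 * e 4 * β ^ 3)

theorem exists_form4_line (e : Fin 5 → ℂ) (α β γ δ : ℂ) : ∃ e' : Fin 5 → ℂ,
    (∀ x y, form4 e (α * x + γ * y) (β * x + δ * y) = form4 e' x y) ∧
      e' 0 = form4 e α β ∧ e' 1 = polar4 e α β γ δ := by
  refine ⟨![form4 e α β, polar4 e α β γ δ, e 0 * (6 * α ^ 2 * γ ^ 2)
      + e 1 * (3 * α ^ 2 * γ * δ + 3 * α * γ ^ 2 * β) + e 2 * (α ^ 2 * δ ^ 2 + 4 * α * β * γ * δ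
      + β ^ 2 * γ ^ 2) + e 3 * (3 * β ^ 2 * γ * δ + 3 * β * δ ^ 2 * α) + e 4 * (6 * β ^ 2 * δ ^ 2),
      polar4 e γ δ α β, form4 e γ δ], fun x y => ?_, rfl, rfl⟩
  simp [form4, polar4]
  ring

theorem form4_eq_zero {e : Fin 5 → ℂ} (h : ∀ t, form4 e 1 t = 0) : e = 0 := by
  have h0 := h 0
  have h1 := h 1
  have h2 := h (-1)
  have h3 := h 2
  have h4 := h (-2)
  simp only [form4] at h0 h1 h2 h3 h4
  ext i
  fin_cases i <;> simp only [Pi.zero_apply]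
  · show e 0 = 0
    linear_combination h0
  · show e 1 = 0
    linear_combination (2 / 3) * h1 - (2 / 3) * h2 - (1 / 12) * h3 + (1 / 12) * h4
  · show e 2 = 0
    linear_combination (- 5 / 4) * h0 + (2 / 3) * h1 + (2 / 3) * h2 - (1 / 24) * h3 - (1 / 24) * h4
  · show e 3 = 0
    linear_combination (- 1 / 6) * h1 + (1 / 6) * h2 + (1 / 12) * h3 - (1 / 12) * h4
  · show e 4 = 0
    linear_combination (1 / 4) * h0 - (1 / 6) * h1 - (1 / 6) * h2 + (1 / 24) * h3 + (1 / 24) * h4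

theorem exists_sq_of_polar4 {e : Fin 5 → ℂ}
    (h : ∀ α β γ δ, α * δ - β * γ ≠ 0 → form4 e α β = 0 → polar4 e α β γ δ = 0) :
    ∃ m₀ m₁ m₂ : ℂ, ∀ s t, form4 e s t = (m₀ * s ^ 2 + m₁ * s * t + m₂ * t ^ 2) ^ 2 := by
  have hroot : ∀ r, form4 e r 1 = 0 → 4 * e 0 * r ^ 3 + 3 * e 1 * r ^ 2 + 2 * e 2 * r + e 3 = 0 := by
    intro r hr
    have := h r 1 1 0 (by norm_num) hr
    simp only [polar4] at this
    linear_combination this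
  by_cases h0 : e 0 = 0
  · have h1 : e 1 = 0 := by
      have := h 1 0 0 1 (by norm_num) (by simp [form4, h0])
      simp only [polar4] at this
      linear_combination this
    by_cases h2 : e 2 = 0
    · have h3 : e 3 = 0 := by
        by_contra h3
        have := hroot (- e 4 / e 3) (by simp only [form4, h0, h1, h2]; field_simp; ring)
        apply h3
        rw [h0, h1, h2] at this
        linear_combination this
      obtain ⟨w, hw⟩ := exists_sq_root (e 4)
      refine ⟨0, 0, w, fun s t => ?_⟩
      rw [form4, h0, h1, h2, h3, ← hw]
      ring
    · obtain ⟨δ, hδ⟩ := exists_sq_root (e 3 ^ 2 - 4 * e 2 * e 4)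
      set r := (δ - e 3) / (2 * e 2) with hr
      have hrr : 2 * e 2 * r = δ - e 3 := by rw [hr]; field_simp
      have hq : e 2 * r ^ 2 + e 3 * r + e 4 = 0 := by
        apply mul_left_cancel₀ (mul_ne_zero (show (4 : ℂ) ≠ 0 by norm_num) h2)
        linear_combination (2 * e 2 * r + δ + e 3) * hrr + hδ
      have := hroot r (by simp only [form4, h0, h1]; linear_combination hq)
      rw [h0, h1] at this
      have h3 : e 3 = - 2 * e 2 * r := by linear_combination this
      have h4 : e 4 = e 2 * r ^ 2 := by linear_combination hq - r * this
      obtain ⟨w, hw⟩ := exists_sq_root (e 2)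
      refine ⟨0, w, - w * r, fun s t => ?_⟩
      rw [form4, h0, h1, h3, h4, ← hw]
      ring
  · obtain ⟨r, hr⟩ : ∃ r, form4 e r 1 = 0 := by
      have := IsAlgClosed.exists_root (Polynomial.C (e 0) * Polynomial.X ^ 4 +
        Polynomial.C (e 1) * Polynomial.X ^ 3 + Polynomial.C (e 2) * Polynomial.X ^ 2 +
        Polynomial.C (e 3) * Polynomial.X + Polynomial.C (e 4)) (by
          have : (Polynomial.C (e 0) * Polynomial.X ^ 4 +
            Polynomial.C (e 1) * Polynomial.X ^ 3 + Polynomial.C (e 2) * Polynomial.X ^ 2 +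
            Polynomial.C (e 3) * Polynomial.X + Polynomial.C (e 4)).degree = 4 := by
            compute_degree!
          rw [this]; norm_num)
      obtain ⟨r, hr⟩ := this
      refine ⟨r, ?_⟩
      simp [Polynomial.IsRoot] at hr
      simp only [form4]
      linear_combination hr
    have hr' := hroot r hr
    set q1 := e 1 + 2 * r * e 0 with hq1
    set q0 := e 2 + 2 * r * q1 - r ^ 2 * e 0 with hq0
    have e1 : e 1 = q1 - 2 * r * e 0 := by rw [hq1]; ring
    have e2 : e 2 = q0 - 2 * r * q1 + r ^ 2 * e 0 := by rw [hq0]; ring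
    have e3 : e 3 = r ^ 2 * q1 - 2 * r * q0 := by
      rw [e1, e2] at hr'; linear_combination hr'
    have e4 : e 4 = r ^ 2 * q0 := by
      simp only [form4] at hr
      rw [e1, e2, e3] at hr
      linear_combination hr
    have hfac : ∀ s t, form4 e s t = (s - r * t) ^ 2 * (e 0 * s ^ 2 + q1 * s * t + q0 * t ^ 2) := by
      intro s t
      rw [form4, e1, e2, e3, e4]; ring
    have hroot' : ∀ ρ, ρ ≠ r → e 0 * ρ ^ 2 + q1 * ρ + q0 = 0 → 2 * e 0 * ρ + q1 = 0 := by
      intro ρ hρ hq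
      have := hroot ρ (by rw [hfac]; linear_combination (ρ - r) ^ 2 * hq)
      apply mul_left_cancel₀ (pow_ne_zero 2 (sub_ne_zero.2 hρ))
      rw [e1, e2, e3] at this
      linear_combination this - 2 * (ρ - r) * hq
    have hdisc : q1 ^ 2 - 4 * e 0 * q0 = 0 := by
      obtain ⟨δ, hδ⟩ := exists_sq_root (q1 ^ 2 - 4 * e 0 * q0)
      by_contra hne
      have hδ0 : δ ≠ 0 := by rintro rfl; apply hne; rw [← hδ]; ring
      have main : ∀ ε, ε ^ 2 = q1 ^ 2 - 4 * e 0 * q0 → (ε - q1) / (2 * e 0) = r := by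
        intro ε hε
        by_contra hx
        set ρ := (ε - q1) / (2 * e 0) with hρ
        have hrr : 2 * e 0 * ρ = ε - q1 := by rw [hρ]; field_simp
        have := hroot' ρ hx (by
          apply mul_left_cancel₀ (mul_ne_zero (show (4 : ℂ) ≠ 0 by norm_num) h0)
          linear_combination (2 * e 0 * ρ + ε + q1) * hrr + hε)
        apply hne
        rw [← hε]
        have : ε = 0 := by linear_combination this - hrr
        rw [this]; ring
      have h1 := main δ hδ
      have h2 := main (-δ) (by rw [← hδ]; ring)
      rw [← h1] at h2
      field_simp at h2
      apply hδ0
      linear_combination (-1/2) * h2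
    obtain ⟨w, hw⟩ := exists_sq_root (e 0)
    have hw0 : w ≠ 0 := by rintro rfl; apply h0; rw [← hw]; ring
    have hsq : ∀ s t, e 0 * s ^ 2 + q1 * s * t + q0 * t ^ 2 = (w * s + q1 / (2 * w) * t) ^ 2 := by
      intro s t
      rw [← hw] at hdisc ⊢
      field_simp
      linear_combination (-1) * t ^ 2 * hdisc
    refine ⟨w, q1 / (2 * w) - r * w, - r * (q1 / (2 * w)), fun s t => ?_⟩
    rw [hfac, hsq]
    ring

/-- The restriction of `H` to the plane spanned by `v` and `w` is the square of a quadratic form. -/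
def SqOn (H : MvPolynomial (Fin 3) ℂ) (v w : Fin 3 → ℂ) : Prop :=
  ∃ m₀ m₁ m₂ : ℂ, ∀ s t, eval (s • v + t • w) H = (m₀ * s ^ 2 + m₁ * s * t + m₂ * t ^ 2) ^ 2

theorem eval_smul_of_homogeneous {σ : Type*} {H : MvPolynomial σ ℂ} {n : ℕ}
    (hH : H.IsHomogeneous n) (c : ℂ) (w : σ → ℂ) : eval (c • w) H = c ^ n * eval w H := by
  rw [eval_eq, eval_eq, Finset.mul_sum]
  refine Finset.sum_congr rfl fun m hm => ?_
  have := hH (mem_support_iff.1 hm)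
  rw [Finsupp.weight_apply, Finsupp.sum] at this
  simp only [Pi.one_apply, smul_eq_mul, mul_one] at this
  simp only [Pi.smul_apply, smul_eq_mul, mul_pow, Finset.prod_mul_distrib]
  rw [Finset.prod_pow_eq_pow_sum, this]
  ring

theorem mk_mem_curve_iff {H : MvPolynomial (Fin 3) ℂ} {n : ℕ} (hH : H.IsHomogeneous n)
    {w : Fin 3 → ℂ} (hw : w ≠ 0) : Projectivization.mk ℂ w hw ∈ curve H ↔ eval w H = 0 := by
  refine ⟨fun h => h w hw rfl, fun h w' hw' e => ?_⟩
  obtain ⟨c, rfl⟩ := (Projectivization.mk_eq_mk_iff' ℂ _ _ hw' hw).1 e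
  rw [eval_smul_of_homogeneous hH, h, mul_zero]

theorem mem_lineThrough_iff {v w a : Fin 3 → ℂ} (ha : a ≠ 0) :
    Projectivization.mk ℂ a ha ∈ lineThrough v w ↔ ∃ s t : ℂ, a = s • v + t • w := by
  constructor
  · rintro ⟨s, t, h, e⟩
    obtain ⟨c, rfl⟩ := (Projectivization.mk_eq_mk_iff' ℂ _ _ ha h).1 e
    exact ⟨c * s, c * t, by simp [smul_smul]⟩
  · rintro ⟨s, t, rfl⟩
    exact ⟨s, t, ha, rfl⟩

theorem lineThrough_subset {v w v' w' : Fin 3 → ℂ} {α β γ δ : ℂ} (hv : v' = α • v + β • w)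
    (hw : w' = γ • v + δ • w) : lineThrough v' w' ⊆ lineThrough v w := by
  rintro _ ⟨s, t, h, rfl⟩
  rw [mem_lineThrough_iff h]
  exact ⟨s * α + t * γ, s * β + t * δ, by rw [hv, hw]; module⟩

theorem linearIndependent_comb {v w : Fin 3 → ℂ} (hvw : LinearIndependent ℂ ![v, w])
    {α β γ δ : ℂ} (h : α * δ - β * γ ≠ 0) :
    LinearIndependent ℂ ![α • v + β • w, γ • v + δ • w] := by
  rw [LinearIndependent.pair_iff] at hvw ⊢
  intro s t hst
  obtain ⟨h1, h2⟩ := hvw (s * α + t * γ) (s * β + t * δ) (by rw [← hst]; module)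
  constructor
  · apply mul_right_cancel₀ h; linear_combination δ * h1 - γ * h2
  · apply mul_right_cancel₀ h; linear_combination α * h2 - β * h1

theorem lineThrough_comb {v w : Fin 3 → ℂ} {α β γ δ : ℂ} (h : α * δ - β * γ ≠ 0) :
    lineThrough (α • v + β • w) (γ • v + δ • w) = lineThrough v w := by
  obtain ⟨D, hD⟩ : ∃ D, D = α * δ - β * γ := ⟨_, rfl⟩
  rw [← hD] at h
  refine Set.Subset.antisymm (lineThrough_subset rfl rfl)
    (lineThrough_subset (α := δ / D) (β := - β / D) (γ := - γ / D) (δ := α / D) ?_ ?_)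
  · ext i; simp; field_simp; rw [hD]; ring
  · ext i; simp; field_simp; rw [hD]; ring

theorem exists_comb_of_lineThrough_eq {v w a b : Fin 3 → ℂ} 
    (hab : LinearIndependent ℂ ![a, b]) (h : lineThrough v w = lineThrough a b) :
    ∃ α β γ δ : ℂ, a = α • v + β • w ∧ b = γ • v + δ • w ∧ α * δ - β * γ ≠ 0 := by
  have ha : a ≠ 0 := hab.ne_zero 0
  have hb : b ≠ 0 := hab.ne_zero 1
  obtain ⟨α, β, h1⟩ := (mem_lineThrough_iff ha).1 (h ▸ (mem_lineThrough_iff ha).2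
    ⟨1, 0, by simp⟩ : Projectivization.mk ℂ a ha ∈ lineThrough v w)
  obtain ⟨γ, δ, h2⟩ := (mem_lineThrough_iff hb).1 (h ▸ (mem_lineThrough_iff hb).2
    ⟨0, 1, by simp⟩ : Projectivization.mk ℂ b hb ∈ lineThrough v w)
  refine ⟨α, β, γ, δ, h1, h2, fun hdet => ?_⟩
  rw [LinearIndependent.pair_iff] at hab
  obtain ⟨h3, h4⟩ := hab δ (-β) (by
    rw [h1, h2, show δ • (α • v + β • w) + -β • (γ • v + δ • w) = (α * δ - β * γ) • v by module,
      hdet, zero_smul])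
  obtain ⟨h5, h6⟩ := hab γ (-α) (by
    rw [h1, h2, show γ • (α • v + β • w) + -α • (γ • v + δ • w) = - (α * δ - β * γ) • w by module,
      hdet, neg_zero, zero_smul])
  apply ha
  rw [h1, neg_eq_zero.1 h4, neg_eq_zero.1 h6]
  simp

theorem lineRest_eq {H : MvPolynomial (Fin 3) ℂ} {a b : Fin 3 → ℂ} {e : Fin 5 → ℂ}
    (h : ∀ t, eval (a + t • b) H = form4 e 1 t) :
    lineRest H a b = Polynomial.C (e 0) + Polynomial.C (e 1) * Polynomial.X +
      Polynomial.X ^ 2 * (Polynomial.C (e 2) + Polynomial.C (e 3) * Polynomial.X +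
        Polynomial.C (e 4) * Polynomial.X ^ 2) := by
  refine Polynomial.funext fun t => ?_
  rw [eval_lineRest, h]
  simp [form4]
  ring

theorem two_le_multAt_iff {H : MvPolynomial (Fin 3) ℂ} {a b : Fin 3 → ℂ} {e : Fin 5 → ℂ}
    (h : ∀ t, eval (a + t • b) H = form4 e 1 t) (he : e ≠ 0) :
    2 ≤ multAt H a b ↔ e 0 = 0 ∧ e 1 = 0 := by
  have h0 : lineRest H a b ≠ 0 := by
    intro h0
    apply he
    refine form4_eq_zero fun t => ?_
    rw [← h, ← eval_lineRest, h0, Polynomial.eval_zero]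
  rw [multAt, Polynomial.le_rootMultiplicity_iff h0, map_zero, sub_zero, lineRest_eq h,
    dvd_add_left (dvd_mul_right _ _), Polynomial.X_pow_dvd_iff]
  constructor
  · intro hc
    have := hc 0 (by norm_num)
    have := hc 1 (by norm_num)
    simp_all
  · rintro ⟨h1, h2⟩ d -
    simp [h1, h2]

theorem subset_curve_iff {H : MvPolynomial (Fin 3) ℂ} (hH : H.IsHomogeneous 4) {v w : Fin 3 → ℂ} :
    lineThrough v w ⊆ curve H ↔ ∀ s t : ℂ, eval (s • v + t • w) H = 0 := by
  constructor
  · intro h s t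
    by_cases h0 : s • v + t • w = 0
    · rw [h0]
      have := eval_smul_of_homogeneous hH 0 (s • v + t • w)
      simpa using this
    · exact (mk_mem_curve_iff hH h0).1 (h ⟨s, t, h0, rfl⟩)
  · rintro h _ ⟨s, t, h0, rfl⟩
    exact (mk_mem_curve_iff hH h0).2 (h s t)

theorem thetaLine_iff_sqOn {H : MvPolynomial (Fin 3) ℂ} (hH : H.IsHomogeneous 4)
    {v w : Fin 3 → ℂ} (hvw : LinearIndependent ℂ ![v, w]) :
    ThetaLine H (lineThrough v w) ↔ SqOn H v w := by
  obtain ⟨e, he⟩ := exists_form4_eval hH v w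
  have hcomb : ∀ α β γ δ x y : ℂ, eval (x • (α • v + β • w) + y • (γ • v + δ • w)) H
      = form4 e (α * x + γ * y) (β * x + δ * y) := by
    intro α β γ δ x y
    rw [← he]
    congr 2
    module
  have hne : ∀ α β γ δ (e' : Fin 5 → ℂ), α * δ - β * γ ≠ 0 →
      (∀ x y, form4 e (α * x + γ * y) (β * x + δ * y) = form4 e' x y) → e ≠ 0 → e' ≠ 0 := by
    rintro α β γ δ e' hdet h1 h2 rfl
    apply h2
    refine form4_eq_zero fun t => ?_
    obtain ⟨D, hD⟩ : ∃ D, D = α * δ - β * γ := ⟨_, rfl⟩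
    rw [← hD] at hdet
    have := h1 ((δ - γ * t) / D) ((α * t - β) / D)
    convert this using 1
    · congr 1 <;> (field_simp; rw [hD]; ring)
    · simp [form4]
  constructor
  · rintro ⟨-, h | h⟩
    · rw [subset_curve_iff hH] at h
      exact ⟨0, 0, 0, fun s t => by rw [h]; ring⟩
    · by_cases he0 : e = 0
      · exact ⟨0, 0, 0, fun s t => by rw [he, he0]; simp [form4]⟩
      have : ∀ α β γ δ, α * δ - β * γ ≠ 0 → form4 e α β = 0 → polar4 e α β γ δ = 0 := by
        intro α β γ δ hdet hz
        have hab := linearIndependent_comb hvw hdet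
        have ha : α • v + β • w ≠ 0 := hab.ne_zero 0
        have hm := h _ _ hab (lineThrough_comb hdet).symm ha
          ((mk_mem_curve_iff hH ha).2 (by rw [he, hz]))
        obtain ⟨e', h1, h2, h3⟩ := exists_form4_line e α β γ δ
        rw [two_le_multAt_iff (e := e') (fun t => by
          rw [← h1, ← hcomb, one_smul]) (hne α β γ δ e' hdet h1 he0)] at hm
        rw [← h3, hm.2]
      obtain ⟨m₀, m₁, m₂, hm⟩ := exists_sq_of_polar4 this
      exact ⟨m₀, m₁, m₂, fun s t => by rw [he, hm]⟩
  · rintro ⟨m₀, m₁, m₂, hm⟩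
    refine ⟨⟨v, w, hvw, rfl⟩, ?_⟩
    by_cases he0 : e = 0
    · left
      rw [subset_curve_iff hH]
      intro s t
      rw [he, he0]; simp [form4]
    · right
      intro a b hab hS ha hac
      obtain ⟨α, β, γ, δ, rfl, rfl, hdet⟩ := exists_comb_of_lineThrough_eq hab hS
      obtain ⟨e', h1, h2, h3⟩ := exists_form4_line e α β γ δ
      rw [two_le_multAt_iff (e := e') (fun t => by
          rw [← h1, ← hcomb, one_smul]) (hne α β γ δ e' hdet h1 he0), h2]
      rw [mk_mem_curve_iff hH] at hac
      have hz : m₀ * α ^ 2 + m₁ * α * β + m₂ * β ^ 2 = 0 := by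
        rw [hm] at hac
        exact pow_eq_zero_iff (two_ne_zero) |>.1 hac
      refine ⟨by rw [← he, hac], ?_⟩
      set q1 := 2 * m₀ * α * γ + m₁ * (α * δ + β * γ) + 2 * m₂ * β * δ with hq1
      set q2 := m₀ * γ ^ 2 + m₁ * γ * δ + m₂ * δ ^ 2 with hq2
      have h4 : ∀ t, form4 (e' - ![0, 0, q1 ^ 2, 2 * q1 * q2, q2 ^ 2]) 1 t = 0 := by
        intro t
        have h5 := hm (α + γ * t) (β + δ * t)
        have h6 := h1 1 t
        rw [he] at h5
        simp only [mul_one] at h6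
        rw [h5] at h6
        simp only [form4, Pi.sub_apply] at h6 ⊢
        simp
        have h7 : m₀ * (α + γ * t) ^ 2 + m₁ * (α + γ * t) * (β + δ * t) + m₂ * (β + δ * t) ^ 2
          = t * (q1 + q2 * t) := by linear_combination hz
        rw [h7] at h6
        linear_combination - h6
      have := congrFun (form4_eq_zero h4) 1
      simpa using this

theorem derivative_lineRest (H : MvPolynomial (Fin 3) ℂ) (a b : Fin 3 → ℂ) :
    Polynomial.derivative (lineRest H a b)
      = ∑ i, Polynomial.C (b i) * lineRest (pderiv i H) a b := by
  simp only [lineRest]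
  induction H using MvPolynomial.induction_on with
  | C r => simp
  | add P Q hP hQ => simp only [eval₂_add, hP, hQ, map_add, mul_add,
      Finset.sum_add_distrib]
  | mul_X P j hP =>
    rw [eval₂_mul, eval₂_X, Polynomial.derivative_mul, hP]
    simp only [Derivation.leibniz, smul_eq_mul, eval₂_add, eval₂_mul, eval₂_X, pderiv_X]
    fin_cases j <;> simp [Fin.sum_univ_three, Pi.single_apply] <;> ring

theorem coeff_one_lineRest (H : MvPolynomial (Fin 3) ℂ) (a b : Fin 3 → ℂ) :
    (lineRest H a b).coeff 1 = ∑ i, b i * eval a (pderiv i H) := by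
  have h := Polynomial.coeff_derivative (lineRest H a b) 0
  rw [derivative_lineRest, Polynomial.coeff_zero_eq_eval_zero, Polynomial.eval_finsetSum] at h
  simp only [Polynomial.eval_mul, Polynomial.eval_C, eval_lineRest, zero_smul, add_zero] at h
  simpa using h.symm

theorem exists_doubleQuartic_eval {H : MvPolynomial (Fin 3) ℂ} (hH : H.IsHomogeneous 4)
    {a : Fin 3 → ℂ} (ha : a ≠ 0) (hs : IsSingularAt H (Projectivization.mk ℂ a ha))
    (v w : Fin 3 → ℂ) : ∃ (c : Fin 3 → ℂ) (d : Fin 4 → ℂ) (e : Fin 5 → ℂ), ∀ x y z : ℂ,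
      eval (x • v + y • w + z • a) H = doubleQuartic c d e x y z := by
  obtain ⟨k, l, c, d, e, h⟩ := isQuarticForm_eval_comb hH v w a
  simp only at h
  have h0 : eval a H = 0 := hs [] (by norm_num) a ha rfl
  have h1 : ∀ i, eval a (pderiv i H) = 0 := fun i => hs [i] (by norm_num) a ha rfl
  have hk : k = 0 := by
    have := h 0 0 1
    simpa [h0, doubleQuartic, form2, form3, form4, eq_comm] using this
  have hcoef : ∀ x y, l 0 * x + l 1 * y = 0 := by
    intro x y
    have key : lineRest H a (x • v + y • w) = Polynomial.X *
        (Polynomial.C (l 0 * x + l 1 * y) + Polynomial.X * (Polynomial.C (form2 c x y) +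
          Polynomial.C (form3 d x y) * Polynomial.X
          + Polynomial.C (form4 e x y) * Polynomial.X ^ 2)) := by
      refine Polynomial.funext fun t => ?_
      have := h (t * x) (t * y) 1
      rw [eval_lineRest, show a + t • (x • v + y • w) = (t * x) • v + (t * y) • w + (1 : ℂ) • a by
        module, this, hk]
      simp [doubleQuartic, form2, form3, form4]
      ring
    have := coeff_one_lineRest H a (x • v + y • w)
    simpa [key, Polynomial.coeff_X_mul, h1] using this
  exact ⟨c, d, e, fun x y z => by rw [h, hk, hcoef]; ring⟩

theorem coneCoeff_comb {H : MvPolynomial (Fin 3) ℂ} {a v w : Fin 3 → ℂ} {c : Fin 3 → ℂ}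
    {d : Fin 4 → ℂ} {e : Fin 5 → ℂ}
    (h : ∀ x y z : ℂ, eval (x • v + y • w + z • a) H = doubleQuartic c d e x y z) (x y z : ℂ) :
    coneCoeff H a (x • v + y • w + z • a) = form2 c x y := by
  have key : lineRest H a (x • v + y • w + z • a) = Polynomial.X ^ 2 *
      (Polynomial.C (form2 c x y) * (1 + Polynomial.C z * Polynomial.X) ^ 2 +
        Polynomial.X * (Polynomial.C (form3 d x y) * (1 + Polynomial.C z * Polynomial.X)
        + Polynomial.C (form4 e x y) * Polynomial.X)) := by
    refine Polynomial.funext fun t => ?_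
    rw [eval_lineRest, show a + t • (x • v + y • w + z • a)
      = (t * x) • v + (t * y) • w + (1 + t * z) • a by module, h]
    simp [doubleQuartic, form2, form3, form4]
    ring
  rw [coneCoeff, key, Polynomial.coeff_X_pow_mul', if_pos le_rfl, Nat.sub_self,
    Polynomial.coeff_zero_eq_eval_zero]
  simp

theorem exists_comb_of_linearIndependent {u v w : Fin 3 → ℂ}
    (h : LinearIndependent ℂ ![u, v, w]) (b : Fin 3 → ℂ) :
    ∃ x y z : ℂ, b = x • u + y • v + z • w := by
  have h1 := h.span_eq_top_of_card_eq_finrank' (by simp)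
  have h2 : b ∈ Submodule.span ℂ (Set.range ![u, v, w]) := by rw [h1]; trivial
  obtain ⟨c, rfl⟩ := (Submodule.mem_span_range_iff_exists_fun ℂ).1 h2
  exact ⟨c 0, c 1, c 2, by simp [Fin.sum_univ_three]⟩

theorem linearIndependent_triple_iff {u v w : Fin 3 → ℂ} :
    LinearIndependent ℂ ![u, v, w] ↔
      ∀ x y z : ℂ, x • u + y • v + z • w = 0 → x = 0 ∧ y = 0 ∧ z = 0 := by
  rw [Fintype.linearIndependent_iff]
  constructor
  · intro h x y z hxyz
    have := h ![x, y, z] (by simpa [Fin.sum_univ_three] using hxyz)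
    exact ⟨this 0, this 1, this 2⟩
  · intro h g hg
    obtain ⟨h0, h1, h2⟩ := h (g 0) (g 1) (g 2) (by simpa [Fin.sum_univ_three] using hg)
    intro i
    fin_cases i <;> assumption

theorem form2_eq_zero_of_node {H : MvPolynomial (Fin 3) ℂ} {a v w : Fin 3 → ℂ} (ha : a ≠ 0)
    (hb : LinearIndependent ℂ ![v, w, a]) (hn : OrdinaryNode H (Projectivization.mk ℂ a ha))
    {c : Fin 3 → ℂ} {d : Fin 4 → ℂ} {e : Fin 5 → ℂ}
    (h : ∀ x y z : ℂ, eval (x • v + y • w + z • a) H = doubleQuartic c d e x y z)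
    (hc : c 1 ^ 2 - 4 * c 0 * c 2 = 0) : c = 0 := by
  obtain ⟨b₁, b₂, hli, h1, h2⟩ := hn.2 a ha rfl
  obtain ⟨x₁, y₁, z₁, rfl⟩ := exists_comb_of_linearIndependent hb b₁
  obtain ⟨x₂, y₂, z₂, rfl⟩ := exists_comb_of_linearIndependent hb b₂
  rw [coneCoeff_comb h, form2] at h1 h2
  rw [linearIndependent_triple_iff] at hli
  have hdet : x₁ * y₂ - x₂ * y₁ ≠ 0 := by
    intro hdet
    have k1 := hli (-(y₂ * z₁ - y₁ * z₂)) y₂ (-y₁) (by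
      have : -(y₂ * z₁ - y₁ * z₂) • a + y₂ • (x₁ • v + y₁ • w + z₁ • a)
        + -y₁ • (x₂ • v + y₂ • w + z₂ • a) = (x₁ * y₂ - x₂ * y₁) • v := by module
      rw [this, hdet, zero_smul])
    have k2 := hli (-(x₂ * z₁ - x₁ * z₂)) x₂ (-x₁) (by
      have : -(x₂ * z₁ - x₁ * z₂) • a + x₂ • (x₁ • v + y₁ • w + z₁ • a)
        + -x₁ • (x₂ • v + y₂ • w + z₂ • a) = (-(x₁ * y₂ - x₂ * y₁)) • w := by module
      rw [this, hdet, neg_zero, zero_smul])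
    have := (hli (-z₁) 1 0 (by
      rw [neg_eq_zero.1 k1.2.2, neg_eq_zero.1 k2.2.2]; module)).2.1
    exact one_ne_zero this
  have hl : ∀ x y, c 0 * x ^ 2 + c 1 * x * y + c 2 * y ^ 2 = 0 →
      2 * c 0 * x + c 1 * y = 0 ∧ c 1 * x + 2 * c 2 * y = 0 := by
    intro x y hxy
    constructor
    · refine pow_eq_zero_iff two_ne_zero |>.1 ?_
      linear_combination 4 * c 0 * hxy + y ^ 2 * hc
    · refine pow_eq_zero_iff two_ne_zero |>.1 ?_
      linear_combination 4 * c 2 * hxy + x ^ 2 * hc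
  obtain ⟨l1, l2⟩ := hl _ _ h1
  obtain ⟨l3, l4⟩ := hl _ _ h2
  ext i
  fin_cases i
  · show c 0 = 0
    apply mul_right_cancel₀ hdet
    linear_combination (1 / 2) * y₂ * l1 - (1 / 2) * y₁ * l3
  · show c 1 = 0
    apply mul_right_cancel₀ hdet
    linear_combination y₂ * l2 - y₁ * l4
  · show c 2 = 0
    apply mul_right_cancel₀ hdet
    linear_combination (-1 / 2) * x₂ * l2 + (1 / 2) * x₁ * l4

theorem sqOn_through_node_iff {H : MvPolynomial (Fin 3) ℂ} {a v w : Fin 3 → ℂ} {c : Fin 3 → ℂ}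
    {d : Fin 4 → ℂ} {e : Fin 5 → ℂ}
    (h : ∀ x y z : ℂ, eval (x • v + y • w + z • a) H = doubleQuartic c d e x y z) (x y : ℂ) :
    SqOn H a (x • v + y • w) ↔ tangentForm c d e x y = 0 := by
  have hev : ∀ s t : ℂ, eval (s • a + t • (x • v + y • w)) H
      = t ^ 2 * (form2 c x y * s ^ 2 + form3 d x y * s * t + form4 e x y * t ^ 2) := by
    intro s t
    rw [show s • a + t • (x • v + y • w) = (t * x) • v + (t * y) • w + s • a by module, h]
    simp [doubleQuartic, form2, form3, form4]
    ring
  rw [tangentForm]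
  generalize form2 c x y = A at *
  generalize form3 d x y = B at *
  generalize form4 e x y = C at *
  constructor
  · rintro ⟨m₀, m₁, m₂, hm⟩
    have key : ∀ s t, t ^ 2 * (A * s ^ 2 + B * s * t + C * t ^ 2)
        = (m₀ * s ^ 2 + m₁ * s * t + m₂ * t ^ 2) ^ 2 := fun s t => by rw [← hev, hm]
    have h0 : m₀ = 0 := by
      have := key 1 0
      refine pow_eq_zero_iff two_ne_zero |>.1 ?_
      linear_combination -this
    subst h0
    have k1 := key 0 1
    have k2 := key 1 1
    have k3 := key (-1) 1
    have hC : C = m₂ ^ 2 := by linear_combination k1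
    have hA : A = m₁ ^ 2 := by linear_combination (1/2) * k2 + (1/2) * k3 - hC
    have hB : B = 2 * m₁ * m₂ := by linear_combination (1/2) * k2 - (1/2) * k3
    rw [hA, hB, hC]; ring
  · intro hz
    obtain ⟨α, hα⟩ := exists_sq_root A
    obtain ⟨γ, hγ⟩ := exists_sq_root C
    have : B ^ 2 = (2 * α * γ) ^ 2 := by rw [← hα, ← hγ] at hz; linear_combination hz
    rcases sq_eq_sq_iff_eq_or_eq_neg.1 this with hB | hB
    · exact ⟨0, α, γ, fun s t => by rw [hev, hB, ← hα, ← hγ]; ring⟩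
    · exact ⟨0, α, -γ, fun s t => by rw [hev, hB, ← hα, ← hγ]; ring⟩

theorem sqOn_graph_iff {H : MvPolynomial (Fin 3) ℂ} {a v w : Fin 3 → ℂ} {f : ℂ → ℂ → ℂ → ℂ}
    (h : ∀ x y z : ℂ, eval (x • v + y • w + z • a) H = f x y z) (α β : ℂ) :
    SqOn H (v + α • a) (w + β • a) ↔ SqLine f α β := by
  have : ∀ s t : ℂ, eval (s • (v + α • a) + t • (w + β • a)) H = f s t (α * s + β * t) := by
    intro s t
    rw [← h]
    congr 2
    module
  simp only [SqOn, SqLine, this]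

/-- A nodal quartic with the same theta-lines as a general one is proportional to it. -/
theorem eq_smul_of_thetaLine {F G : MvPolynomial (Fin 3) ℂ} (hF : F.IsHomogeneous 4)
    (hG : G.IsHomogeneous 4) {a v w : Fin 3 → ℂ} (ha : a ≠ 0)
    (hb : LinearIndependent ℂ ![v, w, a]) {u : Fin 6 → ℂ} (hu : Generic u) {r : ℂ} (hr : r ≠ 0)
    (hFu : ∀ x y z : ℂ, eval (x • v + y • w + z • a) F = r * nodalQuartic u 1 x y z)
    (hn : OrdinaryNode G (Projectivization.mk ℂ a ha))
    (hθ : ∀ S, ThetaLine G S ↔ ThetaLine F S) : ∃ k : ℂ, k ≠ 0 ∧ G = k • F := by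
  obtain ⟨c, d, e, hGe⟩ := exists_doubleQuartic_eval hG ha hn.1.1 v w
  have hli := linearIndependent_triple_iff.1 hb
  have hD : ∀ x y, ¬ (x = 0 ∧ y = 0) →
      (tangentForm c d e x y = 0 ↔ ∏ j, (x - u j ^ 2 * y) = 0) := by
    intro x y hxy
    have hind : LinearIndependent ℂ ![a, x • v + y • w] := by
      rw [LinearIndependent.pair_iff]
      intro s t hst
      obtain ⟨h1, h2, h3⟩ := hli (t * x) (t * y) s (by rw [← hst]; module)
      refine ⟨h3, ?_⟩
      by_contra ht
      exact hxy ⟨(mul_eq_zero.1 h1).resolve_left ht, (mul_eq_zero.1 h2).resolve_left ht⟩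
    have hFe : ∀ x y z : ℂ, eval (x • v + y • w + z • a) F = doubleQuartic ![0, r, 0]
        ![r * (2 * sexticCoeff u 1 0), r * (2 * sexticCoeff u 1 2), r * (2 * sexticCoeff u 1 4),
          r * (2 * sexticCoeff u 1 6)]
        ![r * (sexticCoeff u 1 1 ^ 2), r * (2 * sexticCoeff u 1 1 * sexticCoeff u 1 3),
          r * (sexticCoeff u 1 3 ^ 2 + 2 * sexticCoeff u 1 1 * sexticCoeff u 1 5),
          r * (2 * sexticCoeff u 1 3 * sexticCoeff u 1 5), r * (sexticCoeff u 1 5 ^ 2)] x y z := by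
      intro x y z
      rw [hFu]
      simp [doubleQuartic, nodalQuartic, form2, form3, form4, evenPart, oddPart]
      ring
    rw [← sqOn_through_node_iff hGe, ← thetaLine_iff_sqOn hG hind, hθ, thetaLine_iff_sqOn hF hind,
      sqOn_through_node_iff hFe]
    have : tangentForm ![0, r, 0]
        ![r * (2 * sexticCoeff u 1 0), r * (2 * sexticCoeff u 1 2), r * (2 * sexticCoeff u 1 4),
          r * (2 * sexticCoeff u 1 6)]
        ![r * (sexticCoeff u 1 1 ^ 2), r * (2 * sexticCoeff u 1 1 * sexticCoeff u 1 3),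
          r * (sexticCoeff u 1 3 ^ 2 + 2 * sexticCoeff u 1 1 * sexticCoeff u 1 5),
          r * (2 * sexticCoeff u 1 3 * sexticCoeff u 1 5), r * (sexticCoeff u 1 5 ^ 2)] x y
        = (4 * r ^ 2) * ∏ j, (x - u j ^ 2 * y) := by
      have h1 := tangentForm_nodalQuartic u 1 x y
      simp only [Pi.one_apply, one_pow, one_mul] at h1
      rw [evenPart, oddPart] at h1
      simp [tangentForm, form2, form3, form4]
      linear_combination r ^ 2 * h1
    rw [this, mul_eq_zero, or_iff_right (by simpa using hr)]
  have hc : c 1 ^ 2 - 4 * c 0 * c 2 ≠ 0 := by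
    intro hc
    obtain rfl := form2_eq_zero_of_node ha hb hn hGe hc
    have hroot : ∀ j, form3 d (u j ^ 2) 1 = 0 := by
      intro j
      have := (hD (u j ^ 2) 1 (by simp)).2 (Finset.prod_eq_zero (Finset.mem_univ j) (by ring))
      simpa [tangentForm, form2] using this
    have := coeff_eq_zero_of_roots (n := 6) (fun i => match i with
      | 0 => d 3
      | 1 => d 2
      | 2 => d 1
      | 3 => d 0
      | _ => 0) (fun j => u j ^ 2) (fun i j hij => by_contra fun h => hu.2.1 i j h hij) (fun j => by
        have := hroot j
        simp only [form3] at this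
        simp only [Finset.sum_range_succ, Finset.sum_range_zero]
        linear_combination this) 3 (by norm_num)
    simp only at this
    have h1 := (hD 1 0 (by simp)).1 (by simp [tangentForm, form2, form3, this])
    simp at h1
  have hL : ∀ α β, SqLine (doubleQuartic c d e) α β → SqLine (nodalQuartic u 1) α β := by
    intro α β h
    have hind : LinearIndependent ℂ ![v + α • a, w + β • a] := by
      rw [LinearIndependent.pair_iff]
      intro s t hst
      obtain ⟨h1, h2, -⟩ := hli s t (s * α + t * β) (by rw [← hst]; module)
      exact ⟨h1, h2⟩
    rw [← sqOn_graph_iff hGe, ← thetaLine_iff_sqOn hG hind, hθ, thetaLine_iff_sqOn hF hind,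
      sqOn_graph_iff (f := fun x y z => r * nodalQuartic u 1 x y z) hFu] at h
    exact h.of_mul (r := r⁻¹) fun x y z => by field_simp
  obtain ⟨ρ, hρ, h⟩ := quartic_unique hu hc hD hL
  refine ⟨ρ / r, div_ne_zero hρ hr, MvPolynomial.funext fun b => ?_⟩
  obtain ⟨x, y, z, rfl⟩ := exists_comb_of_linearIndependent hb b
  rw [hGe, h, smul_eval, hFu]
  field_simp

/-- If there are at least as many polynomials `φ i` as variables, then a nonempty Zariski open
condition on the source is implied by one on the target. -/
theorem exists_generic_target {ι τ : Type} [Fintype ι] [Fintype τ]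
    (hcard : Fintype.card τ ≤ Fintype.card ι) (φ : ι → MvPolynomial τ ℂ) {R : MvPolynomial τ ℂ}
    (hR : R ≠ 0) : ∃ P : MvPolynomial ι ℂ, P ≠ 0 ∧
      ∀ θ, eval (fun i => eval θ (φ i)) P ≠ 0 → eval θ R ≠ 0 := by
  have hdep : ¬ AlgebraicIndependent ℂ (fun o : Option ι => o.elim R φ) := by
    intro h
    have h1 := h.cardinalMk_le_trdeg
    rw [MvPolynomial.trdeg_of_isDomain] at h1
    simp at h1
    omega
  rw [algebraicIndependent_iff] at hdep
  push Not at hdep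
  obtain ⟨S, hS, hS0⟩ := hdep
  set T := optionEquivLeft ℂ ι S with hT
  have hT0 : T ≠ 0 := by simpa [hT] using hS0
  have hTR : Polynomial.eval₂ (aeval φ : MvPolynomial ι ℂ →ₐ[ℂ] MvPolynomial τ ℂ).toRingHom R T
      = 0 := by
    rw [← hS, hT]
    clear * -
    induction S using MvPolynomial.induction_on with
    | C a => simp
    | add p q hp hq => rw [map_add, map_add, Polynomial.eval₂_add, hp, hq]
    | mul_X p o hp => 
      rw [map_mul, map_mul, Polynomial.eval₂_mul, hp]
      cases o <;> simp
  obtain ⟨Q, hQ⟩ : Polynomial.X ^ T.natTrailingDegree ∣ T := Polynomial.X_pow_dvd_iff.2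
    fun d hd => Polynomial.coeff_eq_zero_of_lt_natTrailingDegree hd
  have hQ0 : Q.coeff 0 ≠ 0 := by
    have := Polynomial.trailingCoeff_nonzero_iff_nonzero.2 hT0
    rw [Polynomial.trailingCoeff, ← zero_add T.natTrailingDegree] at this
    nth_rw 1 [hQ] at this
    rwa [Polynomial.coeff_X_pow_mul] at this
  refine ⟨Q.coeff 0, hQ0, fun θ h hθ => h ?_⟩
  rw [hQ, Polynomial.eval₂_mul, Polynomial.eval₂_pow, Polynomial.eval₂_X] at hTR
  have h1 := (mul_eq_zero.1 hTR).resolve_left (pow_ne_zero _ hR)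
  rw [← Polynomial.divX_mul_X_add Q, Polynomial.eval₂_add, Polynomial.eval₂_mul,
    Polynomial.eval₂_X, Polynomial.eval₂_C] at h1
  have h2 := congrArg (eval θ) h1
  simp [hθ] at h2
  rw [← h2, bind₁, map_aeval, ← eval₂_id, coe_eval₂Hom]
  congr 1
  ext; simp

theorem doubleQuartic_injective {c c' : Fin 3 → ℂ} {d d' : Fin 4 → ℂ} {e e' : Fin 5 → ℂ}
    (h : ∀ x y z, doubleQuartic c d e x y z = doubleQuartic c' d' e' x y z) :
    c = c' ∧ d = d' ∧ e = e' := by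
  simp only [doubleQuartic, form2, form3, form4] at h
  have a0 := h 1 0 0
  have a1 := h 1 0 1
  have a2 := h 1 0 (-1)
  have b0 := h 0 1 0
  have b1 := h 0 1 1
  have b2 := h 0 1 (-1)
  have p0 := h 1 1 0
  have p1 := h 1 1 1
  have p2 := h 1 1 (-1)
  have q0 := h 1 (-1) 0
  have q1 := h 1 (-1) 1
  have q2 := h 1 (-1) (-1)
  have r0 := h 1 2 0
  have hc0 : c 0 = c' 0 := by linear_combination (1/2) * a1 + (1/2) * a2 - a0
  have hc2 : c 2 = c' 2 := by linear_combination (1/2) * b1 + (1/2) * b2 - b0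
  have hc1 : c 1 = c' 1 := by
    linear_combination (1/2) * p1 + (1/2) * p2 - p0 - hc0 - hc2
  have hd0 : d 0 = d' 0 := by linear_combination (1/2) * a1 - (1/2) * a2
  have hd3 : d 3 = d' 3 := by linear_combination (1/2) * b1 - (1/2) * b2
  have hd1 : d 1 = d' 1 := by
    linear_combination (1/4) * p1 - (1/4) * p2 - (1/4) * q1 + (1/4) * q2 - hd3
  have hd2 : d 2 = d' 2 := by
    linear_combination (1/4) * p1 - (1/4) * p2 + (1/4) * q1 - (1/4) * q2 - hd0
  have he0 : e 0 = e' 0 := by linear_combination a0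
  have he4 : e 4 = e' 4 := by linear_combination b0
  have he2 : e 2 = e' 2 := by linear_combination (1/2) * p0 + (1/2) * q0 - he0 - he4
  have he3 : e 3 = e' 3 := by
    linear_combination (1/6) * (r0 - he0 - 4 * he2 - 16 * he4 - p0 + q0)
  have he1 : e 1 = e' 1 := by linear_combination (1/2) * p0 - (1/2) * q0 - he3
  refine ⟨?_, ?_, ?_⟩ <;> ext i <;> fin_cases i <;> assumption

section Shear

variable {A : Type*} [CommRing A]

/-- The coefficients of the cubic form `D (x - f y, x - g y)`. -/
def shear3 (f g : A) (D : Fin 4 → A) : Fin 4 → A :=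
  ![D 0 + D 1 + D 2 + D 3,
    -(3 * f * D 0 + (2 * f + g) * D 1 + (f + 2 * g) * D 2 + 3 * g * D 3),
    3 * f ^ 2 * D 0 + (f ^ 2 + 2 * f * g) * D 1 + (g ^ 2 + 2 * f * g) * D 2 + 3 * g ^ 2 * D 3,
    -(f ^ 3 * D 0 + f ^ 2 * g * D 1 + f * g ^ 2 * D 2 + g ^ 3 * D 3)]

/-- The coefficients of the quartic form `E (x - f y, x - g y)`. -/
def shear4 (f g : A) (E : Fin 5 → A) : Fin 5 → A :=
  ![E 0 + E 1 + E 2 + E 3 + E 4,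
    -(4 * f * E 0 + (3 * f + g) * E 1 + (2 * f + 2 * g) * E 2 + (f + 3 * g) * E 3 + 4 * g * E 4),
    6 * f ^ 2 * E 0 + (3 * f ^ 2 + 3 * f * g) * E 1 + (f ^ 2 + 4 * f * g + g ^ 2) * E 2
      + (3 * g ^ 2 + 3 * f * g) * E 3 + 6 * g ^ 2 * E 4,
    -(4 * f ^ 3 * E 0 + (f ^ 3 + 3 * f ^ 2 * g) * E 1 + (2 * f ^ 2 * g + 2 * f * g ^ 2) * E 2
      + (g ^ 3 + 3 * g ^ 2 * f) * E 3 + 4 * g ^ 3 * E 4),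
    f ^ 4 * E 0 + f ^ 3 * g * E 1 + f ^ 2 * g ^ 2 * E 2 + f * g ^ 3 * E 3 + g ^ 4 * E 4]

theorem form3_shear3 (f g : A) (D : Fin 4 → A) (x y : A) :
    form3 (shear3 f g D) x y = form3 D (x - f * y) (x - g * y) := by
  simp [form3, shear3]; ring

theorem form4_shear4 (f g : A) (E : Fin 5 → A) (x y : A) :
    form4 (shear4 f g E) x y = form4 E (x - f * y) (x - g * y) := by
  simp [form4, shear4]; ring

/-- The coefficients of the quartic
`κ (X Y (z - ℓ) ^ 2 + 2 s E (z - ℓ) + s ^ 2 O ^ 2)`, where `X = x - f y`, `Y = x - g y`,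
`ℓ = a X + b Y` and `E`, `O` are the even and odd parts of `∏ j, (U - u j V)`;
here `w = (f, g, κ, s, a, b)`. -/
def nodalCoeff (w u : Fin 6 → A) : Fin 3 ⊕ Fin 4 ⊕ Fin 5 → A :=
  let k := sexticCoeff u 1
  Sum.elim ![w 2, -(w 2 * (w 0 + w 1)), w 2 * (w 0 * w 1)] <| Sum.elim
    (shear3 (w 0) (w 1) ![w 2 * (2 * w 3 * k 0), w 2 * (2 * w 3 * k 2 - 2 * w 4),
      w 2 * (2 * w 3 * k 4 - 2 * w 5), w 2 * (2 * w 3 * k 6)])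
    (shear4 (w 0) (w 1) ![w 2 * (w 3 ^ 2 * k 1 ^ 2 - 2 * w 3 * (k 0 * w 4)),
      w 2 * (w 4 ^ 2 - 2 * w 3 * (k 0 * w 5 + k 2 * w 4) + w 3 ^ 2 * (2 * k 1 * k 3)),
      w 2 * (2 * w 4 * w 5 - 2 * w 3 * (k 2 * w 5 + k 4 * w 4)
        + w 3 ^ 2 * (k 3 ^ 2 + 2 * k 1 * k 5)),
      w 2 * (w 5 ^ 2 - 2 * w 3 * (k 4 * w 5 + k 6 * w 4) + w 3 ^ 2 * (2 * k 3 * k 5)),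
      w 2 * (w 3 ^ 2 * k 5 ^ 2 - 2 * w 3 * (k 6 * w 5))])

theorem doubleQuartic_nodalCoeff (w u : Fin 6 → A) (x y z : A) :
    doubleQuartic (fun i => nodalCoeff w u (.inl i)) (fun i => nodalCoeff w u (.inr (.inl i)))
      (fun i => nodalCoeff w u (.inr (.inr i))) x y z =
    w 2 * ((x - w 0 * y) * (x - w 1 * y)
        * (z - (w 4 * (x - w 0 * y) + w 5 * (x - w 1 * y))) ^ 2
      + 2 * w 3 * evenPart u 1 (x - w 0 * y) (x - w 1 * y)
        * (z - (w 4 * (x - w 0 * y) + w 5 * (x - w 1 * y)))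
      + w 3 ^ 2 * oddPart u 1 (x - w 0 * y) (x - w 1 * y) ^ 2) := by
  simp only [doubleQuartic, nodalCoeff, Sum.elim_inl, Sum.elim_inr, form3_shear3, form4_shear4]
  simp [form2, form3, form4, evenPart, oddPart]
  ring

theorem map_nodalCoeff {B : Type*} [CommRing B] (F : A →+* B) (w u : Fin 6 → A)
    (i : Fin 3 ⊕ Fin 4 ⊕ Fin 5) :
    F (nodalCoeff w u i) = nodalCoeff (F ∘ w) (F ∘ u) i := by
  have hk (n : ℕ) : F (sexticCoeff u 1 n) = sexticCoeff (F ∘ u) 1 n := by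
    rw [map_sexticCoeff]
    congr 1
    ext j
    simp
  have h2 : F 2 = 2 := map_ofNat F 2
  have h3 : F 3 = 3 := map_ofNat F 3
  have h4 : F 4 = 4 := map_ofNat F 4
  have h6 : F 6 = 6 := map_ofNat F 6
  rcases i with i | i | i <;> fin_cases i <;>
    simp [nodalCoeff, shear3, shear4, hk, h2, h3, h4, h6]

end Shear

theorem exists_eq_prod_X_sub_C (P : Polynomial ℂ) :
    ∃ r : Fin P.natDegree → ℂ,
      P = Polynomial.C P.leadingCoeff * ∏ j, (Polynomial.X - Polynomial.C (r j)) := by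
  have hs := IsAlgClosed.splits P
  have hc := hs.natDegree_eq_card_roots
  have hp := hs.eq_prod_roots
  generalize P.roots = m at hc hp
  induction m using Quotient.inductionOn with
  | _ l =>
  replace hc : P.natDegree = l.length := hc
  rw [hc]
  refine ⟨l.get, hp.trans ?_⟩
  congr 1
  rw [← List.prod_ofFn]
  change (l.map fun a => Polynomial.X - Polynomial.C a).prod = _
  congr 1
  exact List.ext_get (by simp) (by simp)

theorem exists_sextic_roots (c : Fin 7 → ℂ) (h : c 0 ≠ 0) :
    ∃ r : Fin 6 → ℂ, ∀ X Y : ℂ,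
      c 0 * X ^ 6 + c 1 * X ^ 5 * Y + c 2 * X ^ 4 * Y ^ 2 + c 3 * X ^ 3 * Y ^ 3
        + c 4 * X ^ 2 * Y ^ 4 + c 5 * X * Y ^ 5 + c 6 * Y ^ 6 = c 0 * ∏ j, (X - r j * Y) := by
  obtain ⟨P, hP⟩ : ∃ P : Polynomial ℂ, P = Polynomial.C (c 0) * Polynomial.X ^ 6
    + Polynomial.C (c 1) * Polynomial.X ^ 5 + Polynomial.C (c 2) * Polynomial.X ^ 4
    + Polynomial.C (c 3) * Polynomial.X ^ 3 + Polynomial.C (c 4) * Polynomial.X ^ 2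
    + Polynomial.C (c 5) * Polynomial.X + Polynomial.C (c 6) := ⟨_, rfl⟩
  have hd : P.natDegree = 6 := by rw [hP]; compute_degree!
  have hl : P.leadingCoeff = c 0 := by
    rw [Polynomial.leadingCoeff, hd, hP]
    simp
  obtain ⟨r, hr⟩ := exists_eq_prod_X_sub_C P
  rw [hl] at hr
  clear hl
  revert r
  rw [hd]
  intro r hr
  refine ⟨r, fun X Y => ?_⟩
  by_cases hY : Y = 0
  · subst hY
    simp
  · have := congrArg (Polynomial.eval (X / Y)) hr
    rw [hP] at this
    simp [Fin.prod_univ_six] at this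
    field_simp at this
    simp only [Fin.prod_univ_six]
    linear_combination this

theorem exists_eq_nodalCoeff_of_roots (c : Fin 3 → ℂ) (d : Fin 4 → ℂ) (e : Fin 5 → ℂ) {f g : ℂ}
    (hc : c 0 ≠ 0) (hfg : f ≠ g) (h1 : c 1 = -(c 0 * (f + g))) (h2 : c 2 = c 0 * (f * g))
    (hd : form3 d g 1 ≠ 0) :
    ∃ w u : Fin 6 → ℂ, w 0 ≠ w 1 ∧ w 2 ≠ 0 ∧ w 3 ≠ 0 ∧
      nodalCoeff w u = Sum.elim c (Sum.elim d e) := by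
  obtain ⟨Δ, hΔ⟩ : ∃ Δ, Δ = g - f := ⟨_, rfl⟩
  have hΔ0 : Δ ≠ 0 := by rw [hΔ]; exact sub_ne_zero.2 hfg.symm
  obtain ⟨d', hd'⟩ := form3_subst (fun i => d i / c 0) (g / Δ) (-f / Δ) (1 / Δ) (-1 / Δ)
  obtain ⟨e', he'⟩ := form4_subst (fun i => e i / c 0) (g / Δ) (-f / Δ) (1 / Δ) (-1 / Δ)
  have hd0 : d' 0 = form3 d g 1 / (c 0 * Δ ^ 3) := by
    have := hd' 1 0
    simp only [form3] at this ⊢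
    field_simp at this ⊢
    linear_combination -this
  have hd0' : d' 0 ≠ 0 := by rw [hd0]; positivity
  obtain ⟨r, hr⟩ := exists_sextic_roots
    ![d' 0 ^ 2, 2 * d' 0 * d' 1 - 4 * e' 0, d' 1 ^ 2 + 2 * d' 0 * d' 2 - 4 * e' 1,
      2 * d' 0 * d' 3 + 2 * d' 1 * d' 2 - 4 * e' 2, d' 2 ^ 2 + 2 * d' 1 * d' 3 - 4 * e' 3,
      2 * d' 2 * d' 3 - 4 * e' 4, d' 3 ^ 2] (by simpa using hd0')
  simp at hr
  obtain ⟨u, hu, hu3⟩ := exists_sq_roots_prod r (d' 3 / (d' 0 / 2)) (by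
    have := hr 0 1
    simp [Fin.prod_univ_six] at this ⊢
    field_simp
    linear_combination 4 * this)
  obtain ⟨s, hs⟩ : ∃ s, s = d' 0 / 2 := ⟨_, rfl⟩
  have hs0 : s ≠ 0 := by rw [hs]; simpa using hd0'
  have hds : d' 0 = 2 * s := by rw [hs]; ring
  rw [← hs] at hu3
  have hu3' : d' 3 = 2 * s * ∏ j, u j := by
    field_simp at hu3; linear_combination hu3
  set p : Fin 6 → ℂ := Function.update u 0 (s * u 0)
  set q : Fin 6 → ℂ := Function.update 1 0 s
  have hk (n : ℕ) : sexticCoeff p q n = s * sexticCoeff u 1 n := by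
    cases n
    · simp [sexticCoeff, mulLin, q]
    · simp [sexticCoeff, mulLin, p, q]
      ring
  have key := nodal_normal_form p q d' e' (fun X Y => by
      have := hr X Y
      simp only [form3, form4, Fin.prod_univ_six, ← hu, p, q] at this ⊢
      simp
      rw [hds] at this ⊢
      linear_combination this)
    (by simp [q, Fin.prod_univ_six, hds]) (by simp [p, Fin.prod_univ_six, hu3']; ring)
  obtain ⟨a, ha⟩ : ∃ a, a = (2 * sexticCoeff p q 2 - d' 1) / 2 := ⟨_, rfl⟩
  obtain ⟨b, hb⟩ : ∃ b, b = (2 * sexticCoeff p q 4 - d' 2) / 2 := ⟨_, rfl⟩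
  rw [← ha, ← hb] at key
  simp only [nodalQuartic, evenPart, oddPart, hk] at key
  refine ⟨![f, g, c 0, s, a, b], u, by simpa, by simpa, by simpa, ?_⟩
  obtain ⟨H1, H2, H3⟩ := doubleQuartic_injective
    (c := fun i => nodalCoeff ![f, g, c 0, s, a, b] u (.inl i))
    (d := fun i => nodalCoeff ![f, g, c 0, s, a, b] u (.inr (.inl i)))
    (e := fun i => nodalCoeff ![f, g, c 0, s, a, b] u (.inr (.inr i)))
    (c' := c) (d' := d) (e' := e) (by
      intro x y z
      rw [doubleQuartic_nodalCoeff]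
      have hx : g / Δ * (x - f * y) + -f / Δ * (x - g * y) = x := by
        field_simp; rw [hΔ]; ring
      have hy : 1 / Δ * (x - f * y) + -1 / Δ * (x - g * y) = y := by
        field_simp; rw [hΔ]; ring
      have k1 := key (x - f * y) (x - g * y) z
      rw [← hd', ← he', hx, hy] at k1
      have k3 : form3 (fun i => d i / c 0) x y = form3 d x y / c 0 := by
        simp only [form3]; ring
      have k4 : form4 (fun i => e i / c 0) x y = form4 e x y / c 0 := by
        simp only [form4]; ring
      rw [k3, k4] at k1
      have k5 : c 0 * (form3 d x y / c 0) = form3 d x y := by field_simp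
      have k6 : c 0 * (form4 e x y / c 0) = form4 e x y := by field_simp
      simp only [doubleQuartic, form2, evenPart, oddPart, h1, h2]
      simp
      linear_combination -c 0 * k1 + z * k5 + k6)
  ext i
  rcases i with i | i | i
  · exact congrFun H1 i
  · exact congrFun H2 i
  · exact congrFun H3 i

theorem exists_eq_nodalCoeff (c : Fin 3 → ℂ) (d : Fin 4 → ℂ) (e : Fin 5 → ℂ)
    (hc : c 0 ≠ 0) (hdisc : c 1 ^ 2 - 4 * c 0 * c 2 ≠ 0)
    (hN : c 0 ^ 2 * d 2 - c 0 * c 2 * d 0 - c 0 * c 1 * d 1 + c 1 ^ 2 * d 0 ≠ 0) :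
    ∃ w u : Fin 6 → ℂ, w 0 ≠ w 1 ∧ w 2 ≠ 0 ∧ w 3 ≠ 0 ∧
      nodalCoeff w u = Sum.elim c (Sum.elim d e) := by
  obtain ⟨δ, hδ⟩ := exists_sq_root (c 1 ^ 2 - 4 * c 0 * c 2)
  have hδ0 : δ ≠ 0 := by rintro rfl; simp at hδ; exact hdisc hδ.symm
  obtain ⟨f, hf⟩ : ∃ f, f = (-c 1 + δ) / (2 * c 0) := ⟨_, rfl⟩
  obtain ⟨g, hg⟩ : ∃ g, g = (-c 1 - δ) / (2 * c 0) := ⟨_, rfl⟩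
  have hsub : f - g = δ / c 0 := by rw [hf, hg]; field_simp; ring
  have hfg : f ≠ g := fun h => by
    rw [h, sub_self, eq_comm, div_eq_zero_iff] at hsub; tauto
  have h1 : c 1 = -(c 0 * (f + g)) := by rw [hf, hg]; field_simp; ring
  have h2 : c 2 = c 0 * (f * g) := by
    rw [hf, hg]; field_simp; linear_combination hδ
  by_cases h : form3 d g 1 = 0
  · refine exists_eq_nodalCoeff_of_roots c d e hc hfg.symm (by rw [h1]; ring) (by rw [h2]; ring)
      fun h' => hN ?_
    have : (f - g) * (c 0 ^ 2 * d 2 - c 0 * c 2 * d 0 - c 0 * c 1 * d 1 + c 1 ^ 2 * d 0) = 0 := by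
      simp only [form3] at h h'
      rw [h1, h2]
      linear_combination c 0 ^ 2 * (h' - h)
    exact (mul_eq_zero.1 this).resolve_left (sub_ne_zero.2 hfg)
  · exact exists_eq_nodalCoeff_of_roots c d e hc hfg h1 h2 h

theorem exists_frame_nodalQuartic {F : MvPolynomial (Fin 3) ℂ} {b₁ b₂ p₀ : Fin 3 → ℂ}
    (hb : LinearIndependent ℂ ![b₁, b₂, p₀]) {w u : Fin 6 → ℂ} (hfg : w 0 ≠ w 1) 
    (hs : w 3 ≠ 0)
    (hF : ∀ x y z : ℂ, eval (x • b₁ + y • b₂ + z • p₀) F = doubleQuartic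
      (fun i => nodalCoeff w u (.inl i)) (fun i => nodalCoeff w u (.inr (.inl i)))
      (fun i => nodalCoeff w u (.inr (.inr i))) x y z) :
    ∃ v v' : Fin 3 → ℂ, LinearIndependent ℂ ![v, v', w 3 • p₀] ∧
      ∀ x y z : ℂ, eval (x • v + y • v' + z • (w 3 • p₀)) F
        = w 2 * w 3 ^ 2 * nodalQuartic u 1 x y z := by
  obtain ⟨Δ, hΔ⟩ : ∃ Δ, Δ = w 1 - w 0 := ⟨_, rfl⟩
  have hΔ0 : Δ ≠ 0 := by rw [hΔ]; exact sub_ne_zero.2 hfg.symm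
  obtain ⟨v, hv⟩ : ∃ v, v = (w 1 / Δ) • b₁ + (1 / Δ) • b₂ + w 4 • p₀ := ⟨_, rfl⟩
  obtain ⟨v', hv'⟩ : ∃ v, v = (-w 0 / Δ) • b₁ + (-1 / Δ) • b₂ + w 5 • p₀ := ⟨_, rfl⟩
  have key (x y z : ℂ) : x • v + y • v' + z • (w 3 • p₀)
      = ((w 1 * x - w 0 * y) / Δ) • b₁ + ((x - y) / Δ) • b₂
        + (w 4 * x + w 5 * y + w 3 * z) • p₀ := by
    rw [hv, hv']
    module
  refine ⟨v, v', ?_, fun x y z => ?_⟩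
  · rw [linearIndependent_triple_iff] at hb ⊢
    intro x y z h
    rw [key] at h
    obtain ⟨h1, h2, h3⟩ := hb _ _ _ h
    simp only [div_eq_zero_iff, hΔ0, or_false] at h1 h2
    have hy : Δ * y = 0 := by rw [hΔ]; linear_combination h1 - w 1 * h2
    have hy : y = 0 := (mul_eq_zero.1 hy).resolve_left hΔ0
    have hx : x = 0 := by linear_combination h2 + hy
    rw [hx, hy] at h3
    simp [hs] at h3
    exact ⟨hx, hy, h3⟩
  · rw [key, hF, doubleQuartic_nodalCoeff]
    have hx : (w 1 * x - w 0 * y) / Δ - w 0 * ((x - y) / Δ) = x := by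
      field_simp; rw [hΔ]; ring
    have hy : (w 1 * x - w 0 * y) / Δ - w 1 * ((x - y) / Δ) = y := by
      field_simp; rw [hΔ]; ring
    rw [hx, hy, nodalQuartic]
    ring

theorem exists_nodalCoeff_generic :
    ∃ P : MvPolynomial (Fin 3 ⊕ Fin 4 ⊕ Fin 5) ℂ, P ≠ 0 ∧ ∀ y, eval y P ≠ 0 →
      y (.inl 0) ≠ 0 ∧ ∃ w u : Fin 6 → ℂ, w 0 ≠ w 1 ∧ w 2 ≠ 0 ∧ w 3 ≠ 0 ∧ Generic u ∧
        nodalCoeff w u = y := by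
  obtain ⟨R, hR, hgen⟩ := exists_generic
  obtain ⟨P, hP, hPR⟩ := exists_generic_target (ι := Fin 3 ⊕ Fin 4 ⊕ Fin 5) (τ := Fin 6 ⊕ Fin 6)
    (by simp) (nodalCoeff (fun j => X (.inl j)) (fun j => X (.inr j)))
    (R := rename Sum.inr R)
    (fun h => hR (rename_injective _ Sum.inr_injective (by rw [h, map_zero])))
  have hdisc : (X (.inl 1) ^ 2 - 4 * X (.inl 0) * X (.inl 2)
      : MvPolynomial (Fin 3 ⊕ Fin 4 ⊕ Fin 5) ℂ) ≠ 0 := fun h => by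
    simpa using congrArg (eval (Sum.elim ![0, 1, 0] 0)) h
  have hN : (X (.inl 0) ^ 2 * X (.inr (.inl 2)) - X (.inl 0) * X (.inl 2) * X (.inr (.inl 0))
      - X (.inl 0) * X (.inl 1) * X (.inr (.inl 1)) + X (.inl 1) ^ 2 * X (.inr (.inl 0))
      : MvPolynomial (Fin 3 ⊕ Fin 4 ⊕ Fin 5) ℂ) ≠ 0 := fun h => by
    simpa using congrArg (eval (Sum.elim ![0, 1, 0] (Sum.elim ![1, 0, 0, 0] 0))) h
  refine ⟨_, mul_ne_zero (mul_ne_zero (mul_ne_zero hP (X_ne_zero (.inl 0))) hdisc) hN,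
    fun y hy => ?_⟩
  simp only [map_mul, map_add, map_sub, map_pow, eval_X, map_ofNat, mul_ne_zero_iff] at hy
  obtain ⟨⟨⟨hyP, hy0⟩, hyd⟩, hyN⟩ := hy
  obtain ⟨w, u, h1, h2, h3, h4⟩ := exists_eq_nodalCoeff (fun i => y (.inl i))
    (fun i => y (.inr (.inl i))) (fun i => y (.inr (.inr i))) hy0 hyd hyN
  have hy' : nodalCoeff w u = y := by
    rw [h4]; ext i; rcases i with i | i | i <;> rfl
  refine ⟨hy0, w, u, h1, h2, h3, hgen u ?_, hy'⟩
  have := hPR (Sum.elim w u) (by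
    have hw : (eval (Sum.elim w u) ∘ fun j => X (Sum.inl j)) = w := by ext; simp
    have hu : (eval (Sum.elim w u) ∘ fun j => X (Sum.inr j)) = u := by ext; simp
    simpa only [map_nodalCoeff, hw, hu, hy'] using hyP)
  rw [eval_rename] at this
  exact this

theorem exists_homogeneousComponent_ne_zero {σ : Type*} (P : MvPolynomial σ ℂ) {a₀ : σ → ℂ}
    (h : eval a₀ P ≠ 0) :
    ∃ (Q : MvPolynomial σ ℂ) (k : ℕ), Q.IsHomogeneous k ∧ eval a₀ Q ≠ 0 ∧
      ∀ a, eval a Q ≠ 0 → ∃ t : ℂ, t ≠ 0 ∧ eval (t • a) P ≠ 0 := by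
  obtain ⟨k, hk, hk0⟩ : ∃ k ∈ Finset.range (P.totalDegree + 1),
      eval a₀ (homogeneousComponent k P) ≠ 0 := by
    by_contra! hc
    refine h ?_
    rw [← sum_homogeneousComponent P, map_sum]
    exact Finset.sum_eq_zero hc
  refine ⟨_, k, homogeneousComponent_isHomogeneous k P, hk0, fun a ha => ?_⟩
  obtain ⟨q, hq⟩ : ∃ q : Polynomial ℂ, q = ∑ i ∈ Finset.range (P.totalDegree + 1),
    Polynomial.C (eval a (homogeneousComponent i P)) * Polynomial.X ^ i := ⟨_, rfl⟩
  have hq0 : q ≠ 0 := fun h0 => ha <| by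
    have := congrArg (fun p => Polynomial.coeff p k) (hq.symm.trans h0)
    simpa [Polynomial.finsetSum_coeff, Polynomial.coeff_X_pow, Finset.mem_range.1 hk] using this
  by_contra! hc
  refine mul_ne_zero Polynomial.X_ne_zero hq0 (Polynomial.funext fun t => ?_)
  by_cases ht : t = 0
  · simp [ht]
  · have := hc t ht
    rw [← sum_homogeneousComponent P, map_sum] at this
    simp only [eval_smul_of_homogeneous (homogeneousComponent_isHomogeneous _ P)] at this
    rw [hq]
    simp only [Polynomial.eval_mul, Polynomial.eval_finsetSum, Polynomial.eval_C,
      Polynomial.eval_pow, Polynomial.eval_X, Polynomial.eval_zero]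
    simp only [mul_comm (eval a _), this, mul_zero]

/-- The coefficients of a quartic with a double point, in a given frame, are linear functions of
the quartic. -/
theorem exists_linearMap_doubleQuartic (b₁ b₂ p₀ : Fin 3 → ℂ) :
    ∃ Λ : Fin 3 ⊕ Fin 4 ⊕ Fin 5 → (MvPolynomial (Fin 3) ℂ →ₗ[ℂ] ℂ), ∀ F c d e,
      (∀ x y z : ℂ, eval (x • b₁ + y • b₂ + z • p₀) F = doubleQuartic c d e x y z) →
        ∀ i, Λ i F = Sum.elim c (Sum.elim d e) i := by
  let V (x y z : ℂ) : MvPolynomial (Fin 3) ℂ →ₗ[ℂ] ℂ :=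
    (aeval (x • b₁ + y • b₂ + z • p₀)).toLinearMap
  let q₂ (x y : ℂ) := (1 / 2 : ℂ) • (V x y 1 + V x y (-1)) - V x y 0
  let q₃ (x y : ℂ) := (1 / 2 : ℂ) • (V x y 1 - V x y (-1))
  let q₄ (x y : ℂ) := V x y 0
  let s₃ := (1 / 2 : ℂ) • (q₃ 1 1 + q₃ 1 (-1))
  let t₃ := (1 / 2 : ℂ) • (q₃ 1 1 - q₃ 1 (-1))
  let s₄ := (1 / 2 : ℂ) • (q₄ 1 1 + q₄ 1 (-1)) - q₄ 1 0 - q₄ 0 1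
  let t₄ := (1 / 2 : ℂ) • (q₄ 1 1 - q₄ 1 (-1))
  let r₄ := (1 / 6 : ℂ) • (q₄ 1 2 - q₄ 1 0 - (4 : ℂ) • s₄ - (16 : ℂ) • q₄ 0 1 - (2 : ℂ) • t₄)
  refine ⟨Sum.elim ![q₂ 1 0, q₂ 1 1 - q₂ 1 0 - q₂ 0 1, q₂ 0 1]
    (Sum.elim ![q₃ 1 0, t₃ - q₃ 0 1, s₃ - q₃ 1 0, q₃ 0 1]
      ![q₄ 1 0, t₄ - r₄, s₄, r₄, q₄ 0 1]), fun F c d e h i => ?_⟩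
  have hV (x y z : ℂ) : V x y z F = doubleQuartic c d e x y z := by
    rw [← h]
    simp [V, aeval_eq_eval]
  rcases i with i | i | i <;> fin_cases i <;>
    simp [q₂, q₃, q₄, s₃, t₃, s₄, t₄, r₄, hV, doubleQuartic, form2, form3, form4] <;> ring

/-- A linear functional on quartic forms is a linear form in the coefficients. -/
theorem exists_linear_form (Λ : MvPolynomial (Fin 3) ℂ →ₗ[ℂ] ℂ) (n : ℕ) :
    ∃ l : MvPolynomial (Fin 3 →₀ ℕ) ℂ, ∀ F : MvPolynomial (Fin 3) ℂ, F.IsHomogeneous n →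
      ∀ t : ℂ, eval (t • fun m => coeff m F) l = t * Λ F := by
  refine ⟨∑ m ∈ Finset.finsuppAntidiag Finset.univ n, C (Λ (monomial m 1)) * X m,
    fun F hF t => ?_⟩
  have hsub : F.support ⊆ Finset.finsuppAntidiag Finset.univ n := fun m hm => by
    rw [Finset.mem_finsuppAntidiag]
    refine ⟨?_, Finset.subset_univ _⟩
    have := hF (mem_support_iff.1 hm)
    simpa [Finsupp.weight_apply, Finsupp.sum_fintype] using this
  have hF' : F = ∑ m ∈ Finset.finsuppAntidiag Finset.univ n, coeff m F • monomial m (1 : ℂ) := by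
    conv_lhs => rw [F.as_sum]
    rw [Finset.sum_subset hsub fun m _ hm => by
      rw [notMem_support_iff.1 hm, map_zero]]
    simp [smul_monomial]
  conv_rhs => rw [hF', map_sum, Finset.mul_sum]
  rw [map_sum]
  refine Finset.sum_congr rfl fun m _ => ?_
  simp
  ring

theorem exists_frame {p₀ : Fin 3 → ℂ} (hp : p₀ ≠ 0) :
    ∃ b₁ b₂ : Fin 3 → ℂ, LinearIndependent ℂ ![b₁, b₂, p₀] ∧
      ∃ x y z : MvPolynomial (Fin 3) ℂ, x.IsHomogeneous 1 ∧ y.IsHomogeneous 1 ∧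
        z.IsHomogeneous 1 ∧ ∀ α β γ : ℂ, eval (α • b₁ + β • b₂ + γ • p₀) x = α ∧
          eval (α • b₁ + β • b₂ + γ • p₀) y = β ∧ eval (α • b₁ + β • b₂ + γ • p₀) z = γ := by
  obtain ⟨e, he⟩ := SeparatingDual.exists_continuousLinearEquiv_apply_eq (R := ℂ)
    (x := (Pi.single 2 1 : Fin 3 → ℂ)) (y := p₀) (by simp) hp
  have hcomb (α β γ : ℂ) : e.symm (α • e (Pi.single 0 1) + β • e (Pi.single 1 1) + γ • p₀)
      = ![α, β, γ] := by
    rw [← he]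
    simp only [map_add, map_smul, ContinuousLinearEquiv.symm_apply_apply]
    ext i
    fin_cases i <;> simp
  let L (k : Fin 3) : MvPolynomial (Fin 3) ℂ := ∑ j, C (e.symm (Pi.single j 1) k) * X j
  have hL (k : Fin 3) : (L k).IsHomogeneous 1 :=
    IsHomogeneous.sum _ _ _ fun j _ => by
      simpa using (isHomogeneous_C _ _).mul (isHomogeneous_X ℂ j)
  have hLe (k : Fin 3) (w : Fin 3 → ℂ) : eval w (L k) = e.symm w k := by
    conv_rhs => rw [pi_eq_sum_univ' w]
    simp [L, mul_comm]
  refine ⟨e (Pi.single 0 1), e (Pi.single 1 1), ?_, L 0, L 1, L 2, hL 0, hL 1, hL 2,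
    fun α β γ => ?_⟩
  · rw [linearIndependent_triple_iff]
    intro α β γ h
    have := hcomb α β γ
    rw [h, map_zero] at this
    exact ⟨(congrFun this 0).symm, (congrFun this 1).symm, (congrFun this 2).symm⟩
  · simp [hLe, hcomb]

theorem exists_eval_eq_doubleQuartic {p₀ b₁ b₂ : Fin 3 → ℂ} (hp : p₀ ≠ 0)
    {x y z : MvPolynomial (Fin 3) ℂ} (hx : x.IsHomogeneous 1) (hy : y.IsHomogeneous 1)
    (hz : z.IsHomogeneous 1)
    (h : ∀ α β γ : ℂ, eval (α • b₁ + β • b₂ + γ • p₀) x = α ∧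
      eval (α • b₁ + β • b₂ + γ • p₀) y = β ∧ eval (α • b₁ + β • b₂ + γ • p₀) z = γ)
    (c : Fin 3 → ℂ) (d : Fin 4 → ℂ) (e : Fin 5 → ℂ) :
    ∃ F : MvPolynomial (Fin 3) ℂ, F.IsHomogeneous 4 ∧
      IsSingularAt F (Projectivization.mk ℂ p₀ hp) ∧
      ∀ α β γ : ℂ, eval (α • b₁ + β • b₂ + γ • p₀) F = doubleQuartic c d e α β γ := by
  refine ⟨doubleQuartic (fun i => C (c i)) (fun i => C (d i)) (fun i => C (e i)) x y z, ?_, ?_,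
    fun α β γ => ?_⟩
  · have hm (k l m n : ℕ) (hn : k + l + m = n) (a : ℂ) :
        (C a * (x ^ k * y ^ l * z ^ m)).IsHomogeneous n := by
      subst hn
      simpa using (isHomogeneous_C _ a).mul (((hx.pow k).mul (hy.pow l)).mul (hz.pow m))
    have := (((((hm 2 0 2 4 rfl (c 0)).add (hm 1 1 2 4 rfl (c 1))).add (hm 0 2 2 4 rfl (c 2))).add
      ((((hm 3 0 1 4 rfl (d 0)).add (hm 2 1 1 4 rfl (d 1))).add (hm 1 2 1 4 rfl (d 2))).add
        (hm 0 3 1 4 rfl (d 3)))).add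
      (((((hm 4 0 0 4 rfl (e 0)).add (hm 3 1 0 4 rfl (e 1))).add (hm 2 2 0 4 rfl (e 2))).add
        (hm 1 3 0 4 rfl (e 3))).add (hm 0 4 0 4 rfl (e 4))))
    convert this using 1
    simp only [doubleQuartic, form2, form3, form4]
    ring
  · intro l hl w hw hwp
    obtain ⟨t, ht⟩ := (Projectivization.mk_eq_mk_iff' ℂ _ _ _ _).1 hwp
    have hw0 : w = (0 : ℂ) • b₁ + (0 : ℂ) • b₂ + t • p₀ := by simp [ht]
    obtain ⟨hwx, hwy, -⟩ := h 0 0 t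
    rw [← hw0] at hwx hwy
    rcases l with _ | ⟨i, _ | ⟨j, l⟩⟩
    · simp [pderivList, doubleQuartic, form2, form3, form4, hwx, hwy]
    · simp [pderivList, doubleQuartic, form2, form3, form4, hwx, hwy, Derivation.leibniz,
        Derivation.leibniz_pow]
    · simp at hl
  · obtain ⟨h1, h2, h3⟩ := h α β γ
    simp [doubleQuartic, form2, form3, form4, h1, h2, h3]

theorem exists_isHomogeneous_generic {p₀ : Fin 3 → ℂ} (hp : p₀ ≠ 0) :
    ∃ (P : MvPolynomial (Fin 3 →₀ ℕ) ℂ) (k : ℕ), P.IsHomogeneous k ∧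
      (∃ F₀ : MvPolynomial (Fin 3) ℂ, F₀ ≠ 0 ∧ F₀.IsHomogeneous 4 ∧
        IsSingularAt F₀ (Projectivization.mk ℂ p₀ hp) ∧ eval (fun m => coeff m F₀) P ≠ 0) ∧
      ∀ F : MvPolynomial (Fin 3) ℂ, F.IsHomogeneous 4 →
        IsSingularAt F (Projectivization.mk ℂ p₀ hp) → eval (fun m => coeff m F) P ≠ 0 →
        ∃ (v v' : Fin 3 → ℂ) (s r : ℂ) (u : Fin 6 → ℂ), s ≠ 0 ∧ r ≠ 0 ∧ Generic u ∧
          LinearIndependent ℂ ![v, v', s • p₀] ∧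
          ∀ x y z : ℂ, eval (x • v + y • v' + z • (s • p₀)) F = r * nodalQuartic u 1 x y z := by
  obtain ⟨P, hP, hgen⟩ := exists_nodalCoeff_generic
  obtain ⟨b₁, b₂, hb, x, y, z, hx, hy, hz, hxyz⟩ := exists_frame hp
  obtain ⟨Λ, hΛ⟩ := exists_linearMap_doubleQuartic b₁ b₂ p₀
  choose l hl using fun i => exists_linear_form (Λ i) 4
  obtain ⟨θ, hθ⟩ : ∃ θ, eval θ P ≠ 0 := by
    by_contra! hc
    exact hP (MvPolynomial.funext fun θ => by rw [hc θ, map_zero])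
  obtain ⟨F₀, hF₀, hF₀s, hF₀e⟩ := exists_eval_eq_doubleQuartic hp hx hy hz hxyz
    (fun i => θ (.inl i)) (fun i => θ (.inr (.inl i))) (fun i => θ (.inr (.inr i)))
  have hP₀ (F : MvPolynomial (Fin 3) ℂ) (hF : F.IsHomogeneous 4) (t : ℂ) :
      eval (t • fun m => coeff m F) (bind₁ l P) = eval (fun i => t * Λ i F) P := by
    rw [← aeval_eq_eval, aeval_bind₁]
    simp only [aeval_eq_eval, hl _ F hF t]
  have hΛ₀ : (fun i => Λ i F₀) = θ := by
    ext i
    rw [hΛ F₀ _ _ _ hF₀e]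
    rcases i with i | i | i <;> rfl
  obtain ⟨Q, k, hQ, hQ₀, hQt⟩ := exists_homogeneousComponent_ne_zero (bind₁ l P)
    (a₀ := fun m => coeff m F₀) (by
      have := hP₀ F₀ hF₀ 1
      rw [one_smul] at this
      rw [this]
      simpa only [one_mul, hΛ₀] using hθ)
  refine ⟨Q, k, hQ, ⟨F₀, ?_, hF₀, hF₀s, hQ₀⟩, fun F hF hFs hFQ => ?_⟩
  · rintro rfl
    refine (hgen θ hθ).1 ?_
    rw [← hΛ₀]
    exact map_zero _
  · obtain ⟨t, ht, htP⟩ := hQt _ hFQ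
    rw [hP₀ F hF] at htP
    obtain ⟨-, w, u, hfg, hκ, hs, hu, hwu⟩ := hgen _ htP
    obtain ⟨c, d, e, hcde⟩ := exists_doubleQuartic_eval hF hp hFs b₁ b₂
    have hcde' := hΛ F c d e hcde
    obtain ⟨v, v', hv, hvF⟩ := exists_frame_nodalQuartic (F := t • F) (u := u) hb hfg hs (fun α β γ => by
      simp only [hwu, hcde']
      simp [hcde, doubleQuartic, form2, form3, form4]
      ring)
    refine ⟨v, v', w 3, t⁻¹ * (w 2 * w 3 ^ 2), u, hs, by positivity, hu, hv, fun α β γ => ?_⟩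
    rw [mul_assoc, ← hvF, smul_eval, inv_mul_cancel_left₀ ht]

/-- Fix `p ∈ ℙ²` and let `W` be the projective space of quartics
singular at `p`.  The set of irreducible quartics whose only singularity is an ordinary
node at `p` and which fail to be determined, among such quartics, by their theta-lines,
is contained in a proper Zariski-closed subset of `W` (here: the zero locus of a
homogeneous polynomial `P` in the coefficients, not vanishing identically on quartic
forms singular at `p`). -/
theorem general_uninodal_quartic_theta_property (p : P2) :
    ∃ (P : MvPolynomial ((Fin 3) →₀ ℕ) ℂ) (k : ℕ), P.IsHomogeneous k ∧
      (∃ F₀ : MvPolynomial (Fin 3) ℂ, F₀ ≠ 0 ∧ F₀.IsHomogeneous 4 ∧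
        IsSingularAt F₀ p ∧ eval (fun m => coeff m F₀) P ≠ 0) ∧
      ∀ F : MvPolynomial (Fin 3) ℂ,
        F.IsHomogeneous 4 → Irreducible F → OrdinaryNode F p →
        (∀ q : P2, IsSingularAt F q → q = p) →
        eval (fun m => coeff m F) P ≠ 0 →
        ∀ G : MvPolynomial (Fin 3) ℂ,
          G.IsHomogeneous 4 → Irreducible G → OrdinaryNode G p →
          (∀ q : P2, IsSingularAt G q → q = p) →
          {S : Set P2 | ThetaLine G S} = {S : Set P2 | ThetaLine F S} →
          ∃ c : ℂ, c ≠ 0 ∧ G = c • F := by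
  induction p using Projectivization.ind with
  | _ p₀ hp =>
  obtain ⟨P, k, hPk, hP₀, hP⟩ := exists_isHomogeneous_generic hp
  refine ⟨P, k, hPk, hP₀, fun F hF _ hFn _ hFP G hG _ hGn _ hS => ?_⟩
  obtain ⟨v, v', s, r, u, hs, hr, hu, hv, hFe⟩ := hP F hF hFn.1.1 hFP
  have ha : s • p₀ ≠ 0 := smul_ne_zero hs hp
  have hmk : Projectivization.mk ℂ (s • p₀) ha = Projectivization.mk ℂ p₀ hp :=
    (Projectivization.mk_eq_mk_iff' ℂ _ _ _ _).2 ⟨s, rfl⟩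
  rw [← hmk] at hGn
  exact eq_smul_of_thetaLine hF hG ha hv hu hr hFe hGn (Set.ext_iff.1 hS)

end
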